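/- arXiv:1207.0765 — 12 statements merged into one kernel-verified Lean document; each statement's English description precedes it below -/
import Mathlib

section
/- In Maharaja Nim, for every k ∈ ℕ there is exactly one y ∈ ℕ such that (k, y) is a P-position, and exactly one x ∈ ℕ such that (x, k) is a P-position. -/
/-- One move of Maharaja Nim: from `p` to `q` by a Nim move (decrease one
coordinate), a diagonal move (decrease both by the same positive amount), or a
Knight move `(1,2)` or `(2,1)`. -/
def MahMove (p q : ℕ × ℕ) : Prop :=
  (∃ k, 0 < k ∧ q.1 + k = p.1 ∧ q.2 = p.2) ∨
  (∃ k, 0 < k ∧ q.1 = p.1 ∧ q.2 + k = p.2) ∨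
  (∃ k, 0 < k ∧ q.1 + k = p.1 ∧ q.2 + k = p.2) ∨
  (q.1 + 1 = p.1 ∧ q.2 + 2 = p.2) ∨
  (q.1 + 2 = p.1 ∧ q.2 + 1 = p.2)

theorem MahMove.lt {p q : ℕ × ℕ} (h : MahMove p q) : q.1 + q.2 < p.1 + p.2 := by
  rcases h with ⟨k, hk, h1, h2⟩ | ⟨k, hk, h1, h2⟩ | ⟨k, hk, h1, h2⟩ | ⟨h1, h2⟩ | ⟨h1, h2⟩ <;> omega

/-- The P-positions of Maharaja Nim: `p` is P iff every move from `p` leads to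
a non-P position. -/
def MahP (p : ℕ × ℕ) : Prop :=
  ∀ q, MahMove p q → ¬ MahP q
termination_by p.1 + p.2
decreasing_by exact MahMove.lt ‹_›


theorem mahP_iff (p : ℕ × ℕ) : MahP p ↔ ∀ q, MahMove p q → ¬ MahP q := by
  rw [MahP]

theorem mahMove_swap {p q : ℕ × ℕ} (h : MahMove p q) : MahMove p.swap q.swap := by
  rcases h with ⟨k, hk, h1, h2⟩ | ⟨k, hk, h1, h2⟩ | ⟨k, hk, h1, h2⟩ | ⟨h1, h2⟩ | ⟨h1, h2⟩
  · exact Or.inr (Or.inl ⟨k, hk, h2, h1⟩)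
  · exact Or.inl ⟨k, hk, h2, h1⟩
  · exact Or.inr (Or.inr (Or.inl ⟨k, hk, h2, h1⟩))
  · exact Or.inr (Or.inr (Or.inr (Or.inr ⟨h2, h1⟩)))
  · exact Or.inr (Or.inr (Or.inr (Or.inl ⟨h2, h1⟩)))

theorem mahP_swap_aux (n : ℕ) : ∀ p : ℕ × ℕ, p.1 + p.2 < n → MahP p → MahP p.swap := by
  induction n with
  | zero => intro p h; omega
  | succ n ih =>
    intro p hp h
    rw [mahP_iff] at h ⊢
    intro q hq hPq
    have hm : MahMove p q.swap := by simpa using mahMove_swap hq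
    refine h _ hm (ih q ?_ hPq)
    have := hm.lt
    simp only [Prod.fst_swap, Prod.snd_swap] at this
    omega

theorem mahP_swap (a b : ℕ) : MahP (a, b) ↔ MahP (b, a) :=
  ⟨mahP_swap_aux _ (a, b) (Nat.lt_succ_self _), mahP_swap_aux _ (b, a) (Nat.lt_succ_self _)⟩

theorem mahP_col_lt {k y z : ℕ} (hz : MahP (k, z)) (h : y < z) : ¬ MahP (k, y) :=
  (mahP_iff _).1 hz _ (Or.inr (Or.inl ⟨z - y, by omega, rfl, by simp only; omega⟩))

theorem mahP_col_unique {k y z : ℕ} (hy : MahP (k, y)) (hz : MahP (k, z)) : y = z := by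
  rcases lt_trichotomy y z with h | h | h
  · exact absurd hy (mahP_col_lt hz h)
  · exact h
  · exact absurd hz (mahP_col_lt hy h)

theorem mahP_bound (k : ℕ) : ∃ B, ∀ x < k, ∀ y, MahP (x, y) → y ≤ B := by
  induction k with
  | zero => exact ⟨0, fun x hx => by omega⟩
  | succ k ih =>
    obtain ⟨B, hB⟩ := ih
    by_cases h : ∃ z, MahP (k, z)
    · obtain ⟨z, hz⟩ := h
      refine ⟨max B z, fun x hx y hy => ?_⟩
      rcases Nat.lt_succ_iff_lt_or_eq.1 hx with h | rfl
      · exact (hB x h y hy).trans (le_max_left _ _)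
      · rw [mahP_col_unique hy hz]; exact le_max_right _ _
    · refine ⟨B, fun x hx y hy => ?_⟩
      rcases Nat.lt_succ_iff_lt_or_eq.1 hx with h' | rfl
      · exact hB x h' y hy
      · exact absurd ⟨y, hy⟩ h

theorem mahP_col (k : ℕ) : ∃! y : ℕ, MahP (k, y) := by
  suffices h : ∃ y, MahP (k, y) by
    obtain ⟨y, hy⟩ := h
    exact ⟨y, hy, fun z hz => mahP_col_unique hz hy⟩
  by_contra! hno
  obtain ⟨B, hB⟩ := mahP_bound k
  have h := hno (B + k + 3)
  rw [mahP_iff] at h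
  push Not at h
  obtain ⟨⟨a, b⟩, hm, hP⟩ := h
  have hb := fun ha => hB a ha b hP
  rcases hm with ⟨d, hk, h1, h2⟩ | ⟨d, hk, h1, h2⟩ | ⟨d, hk, h1, h2⟩ | ⟨h1, h2⟩ | ⟨h1, h2⟩ <;>
    simp only at h1 h2
  · have := hb (by omega); omega
  · subst h1; exact hno b hP
  · have := hb (by omega); omega
  · have := hb (by omega); omega
  · have := hb (by omega); omega

theorem maharaja_row_column_unique (k : ℕ) :
    (∃! y : ℕ, MahP (k, y)) ∧ (∃! x : ℕ, MahP (x, k)) := by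
  refine ⟨mahP_col k, ?_⟩
  simp_rw [fun x => mahP_swap x k]
  exact mahP_col k
end

section
/- There is a constant C > 0 such that every P-position (x, y) of Maharaja Nim with y ≥ x satisfies |y − φ·x| ≤ C, where φ = (1 + √5)/2 is the golden ratio. -/
/-- The golden ratio `(1 + √5)/2`. -/
noncomputable def phi : ℝ := (1 + Real.sqrt 5) / 2

namespace Mah

/-- Upper/lower P-position predicate in curried form. -/
def P (x y : ℕ) : Prop := MahP (x, y)

theorem P_iff (x y : ℕ) : P x y ↔ ∀ q, MahMove (x, y) q → ¬ MahP q := by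
  unfold P; rw [MahP]

theorem P_symm_aux : ∀ n x y : ℕ, x + y < n → P x y → P y x := by
  intro n
  induction n with
  | zero => intro x y h; omega
  | succ n ih =>
    intro x y h hp
    rw [P_iff] at hp ⊢
    rintro ⟨a, b⟩ hm hq
    have hlt := hm.lt
    simp only at hlt
    have h1 : P b a := ih a b (by omega) hq
    refine hp (b, a) ?_ h1
    rcases hm with ⟨k, hk, h1, h2⟩ | ⟨k, hk, h1, h2⟩ | ⟨k, hk, h1, h2⟩ | ⟨h1, h2⟩ | ⟨h1, h2⟩
    · exact Or.inr (Or.inl ⟨k, hk, h2, h1⟩)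
    · exact Or.inl ⟨k, hk, h2, h1⟩
    · exact Or.inr (Or.inr (Or.inl ⟨k, hk, h2, h1⟩))
    · exact Or.inr (Or.inr (Or.inr (Or.inr ⟨h2, h1⟩)))
    · exact Or.inr (Or.inr (Or.inr (Or.inl ⟨h2, h1⟩)))

theorem P_symm {x y : ℕ} (h : P x y) : P y x := P_symm_aux _ x y (Nat.lt_succ_self _) h

theorem P_row {i x y : ℕ} (h1 : P i y) (h2 : P x y) : ¬ i < x := by
  intro h
  rw [P_iff] at h2
  exact h2 (i, y) (Or.inl ⟨x - i, by omega, by simp only; omega, rfl⟩) h1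

theorem P_col {x y z : ℕ} (h1 : P x y) (h2 : P x z) : y = z := by
  have a := P_row (P_symm h1) (P_symm h2)
  have b := P_row (P_symm h2) (P_symm h1)
  omega

theorem P_diag {i j x y k : ℕ} (h1 : P i j) (h2 : P x y) (hk : 0 < k) (hx : i + k = x)
    (hy : j + k = y) : False := by
  rw [P_iff] at h2
  exact h2 (i, j) (Or.inr (Or.inr (Or.inl ⟨k, hk, hx, hy⟩))) h1

theorem P_diag' {i x c : ℕ} (h1 : P i (i + c)) (h2 : P x (x + c)) : i = x := by
  rcases lt_trichotomy i x with h | h | h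
  · exact (P_diag h1 h2 (k := x - i) (by omega) (by omega) (by omega)).elim
  · exact h
  · exact (P_diag h2 h1 (k := i - x) (by omega) (by omega) (by omega)).elim

theorem P_k1 {i j x y : ℕ} (h1 : P i j) (h2 : P x y) (hx : i + 1 = x) (hy : j + 2 = y) :
    False := by
  rw [P_iff] at h2
  exact h2 (i, j) (Or.inr (Or.inr (Or.inr (Or.inl ⟨hx, hy⟩)))) h1

theorem P_k2 {i j x y : ℕ} (h1 : P i j) (h2 : P x y) (hx : i + 2 = x) (hy : j + 1 = y) :
    False := by
  rw [P_iff] at h2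
  exact h2 (i, j) (Or.inr (Or.inr (Or.inr (Or.inr ⟨hx, hy⟩)))) h1

theorem P_of {x y : ℕ} (h1 : ∀ i < x, ¬ P i y) (h2 : ∀ j < y, ¬ P x j)
    (h3 : ∀ i j k, 0 < k → i + k = x → j + k = y → ¬ P i j)
    (h4 : ∀ i j, i + 1 = x → j + 2 = y → ¬ P i j)
    (h5 : ∀ i j, i + 2 = x → j + 1 = y → ¬ P i j) : P x y := by
  rw [P_iff]
  rintro ⟨a, b⟩ hm hq
  rcases hm with ⟨k, hk, e1, e2⟩ | ⟨k, hk, e1, e2⟩ | ⟨k, hk, e1, e2⟩ | ⟨e1, e2⟩ | ⟨e1, e2⟩ <;>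
    simp only at e1 e2
  · subst e2; exact h1 a (by omega) hq
  · subst e1; exact h2 b (by omega) hq
  · exact h3 a b k hk e1 e2 hq
  · exact h4 a b e1 e2 hq
  · exact h5 a b e1 e2 hq

theorem P_00 : P 0 0 := by
  apply P_of <;> intros <;> omega

/-- `B j`: the column `j` already has its P-position below the diagonal. -/
def B (j : ℕ) : Prop := ∃ i, i < j ∧ P i j

theorem B_col {x y : ℕ} (h : B x) (hy : x ≤ y) : ¬ P x y := by
  intro h2
  obtain ⟨i, hi, hp⟩ := h
  have := P_col (P_symm hp) h2
  omega

/-- State of the transducer. `U`: used differences above `d`; `W`: used rows above `x+d`;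
`M`, `N`: Knight-blocked differences; `u`, `w`: popcounts; `i`, `o`: runs of `B`. -/
structure MSt where
  U : ℕ
  W : ℕ
  M : ℕ
  N : ℕ
  u : ℕ
  w : ℕ
  i : ℕ
  o : ℕ

def MSt.eqb (s t : MSt) : Bool :=
  Nat.beq s.U t.U && Nat.beq s.W t.W && Nat.beq s.M t.M && Nat.beq s.N t.N &&
  Nat.beq s.u t.u && Nat.beq s.w t.w && Nat.beq s.i t.i && Nat.beq s.o t.o

theorem MSt.eq_of_eqb {s t : MSt} (h : s.eqb t = true) : s = t := by
  cases s; cases t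
  simp only [MSt.eqb, Bool.and_eq_true, Nat.beq_eq] at h
  simp only [MSt.mk.injEq]
  tauto

def memb (s : MSt) : List MSt → Bool
  | [] => false
  | t :: l => if MSt.eqb s t then true else memb s l

theorem mem_of_memb {s : MSt} {l : List MSt} (h : memb s l = true) : s ∈ l := by
  induction l with
  | nil => simp [memb] at h
  | cons t l ih =>
    simp only [memb] at h
    split_ifs at h with h1
    · rw [MSt.eq_of_eqb h1]; simp
    · exact List.mem_cons_of_mem _ (ih h)

/-- emitted bit count -/
def b0 (W : ℕ) : ℕ := W % 2

def run (W o : ℕ) : ℕ := (o + 1) * (W % 2)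

def stepD (s : MSt) : MSt :=
  ⟨s.U / 2, s.W / 2, s.M / 2, s.N / 2, s.u - 1, s.w - b0 s.W, s.i, run s.W s.o⟩

def stepB (s : MSt) : MSt :=
  ⟨s.U, s.W / 2, 0, s.M / 4, s.u, s.w - b0 s.W, s.i + 1, run s.W s.o⟩

def stepA (s : MSt) (k : ℕ) : MSt :=
  ⟨s.U ||| 2 ^ k, (s.W ||| 2 ^ k) / 2, 2 ^ (k + 1), s.M / 4, s.u + 1,
    s.w + 1 - b0 (s.W ||| 2 ^ k), 0, run (s.W ||| 2 ^ k) s.o⟩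

def blk (s : MSt) : ℕ := s.U ||| s.W ||| s.M ||| s.N

def bit (n k : ℕ) : Bool := Nat.beq ((n / 2 ^ k) % 2) 1

theorem bit_eq (n k : ℕ) : bit n k = n.testBit k := by
  rw [Nat.testBit_eq_decide_div_mod_eq, bit]
  rw [Bool.eq_iff_iff]
  simp [Nat.beq_eq]

def fk (n : ℕ) : ℕ → ℕ → ℕ
  | 0, k => k
  | f + 1, k => if bit n k then fk n f (k + 1) else k

theorem fk_spec (n : ℕ) : ∀ f k, ∀ j, k ≤ j → j < fk n f k → n.testBit j = true := by
  intro f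
  induction f with
  | zero => intro k j h1 h2; simp [fk] at h2; omega
  | succ f ih =>
    intro k j h1 h2
    rw [fk] at h2
    split_ifs at h2 with h
    · rcases Nat.eq_or_lt_of_le h1 with h3 | h3
      · rw [← h3, ← bit_eq]; exact h
      · exact ih (k + 1) j h3 h2
    · omega

def kk (s : MSt) : ℕ := fk (blk s) 15 0

def good (R : List MSt) (s : MSt) : Bool :=
  Nat.ble s.o 4 && Nat.ble s.i 4 && Nat.ble s.u 13 && Nat.ble s.w 13 &&
  (if bit s.U 0 then
    Nat.ble 1 s.u && Nat.ble (b0 s.W) s.w && memb (stepD s) R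
  else
    (if Nat.ble s.i 3 then Nat.ble (b0 s.W) s.w && memb (stepB s) R else true) &&
    (Nat.ble (kk s) 14 && !bit (blk s) (kk s) && memb (stepA s (kk s)) R &&
      Nat.ble (b0 (s.W ||| 2 ^ kk s)) (s.w + 1)))

def mR : List MSt :=
  [⟨0,0,0,0,0,0,0,0⟩, ⟨0,0,0,0,0,0,1,0⟩, ⟨0,0,0,0,0,0,2,0⟩, ⟨0,0,0,0,0,0,3,0⟩, ⟨0,0,0,0,0,0,4,0⟩,
   ⟨0,0,1,0,0,0,0,0⟩, ⟨1,0,0,0,1,0,0,0⟩, ⟨1,0,1,0,1,0,0,0⟩, ⟨1,0,2,0,1,0,0,1⟩, ⟨2,0,0,0,1,0,0,0⟩,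
   ⟨2,0,0,0,1,0,1,0⟩, ⟨2,0,0,0,1,0,2,0⟩, ⟨2,0,0,0,1,0,3,0⟩, ⟨2,0,0,0,1,0,4,0⟩, ⟨2,0,0,1,1,0,1,1⟩,
   ⟨2,1,4,0,1,1,0,0⟩, ⟨3,0,0,0,2,0,0,0⟩, ⟨3,0,0,1,2,0,0,1⟩, ⟨3,0,1,0,2,0,0,0⟩, ⟨3,0,1,1,2,0,0,2⟩,
   ⟨3,0,2,0,2,0,0,1⟩, ⟨5,0,0,0,2,0,0,0⟩, ⟨5,0,1,0,2,0,0,0⟩, ⟨5,0,1,0,2,0,0,2⟩, ⟨6,0,0,0,2,0,2,1⟩,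
   ⟨6,0,0,0,2,0,3,0⟩, ⟨6,0,0,0,2,0,4,0⟩, ⟨6,1,0,2,2,1,1,0⟩, ⟨6,2,8,0,2,1,0,0⟩, ⟨7,0,0,0,3,0,0,0⟩,
   ⟨7,0,0,0,3,0,0,1⟩, ⟨7,0,0,1,3,0,0,1⟩, ⟨7,0,1,0,3,0,0,0⟩, ⟨7,0,1,0,3,0,0,2⟩, ⟨7,0,1,1,3,0,0,3⟩,
   ⟨7,0,2,0,3,0,0,1⟩, ⟨7,0,2,0,3,0,0,2⟩, ⟨7,1,0,2,3,1,0,0⟩, ⟨7,1,1,2,3,1,0,0⟩, ⟨7,1,2,2,3,1,0,1⟩,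
   ⟨10,0,0,0,2,0,0,0⟩, ⟨10,0,0,0,2,0,0,1⟩, ⟨10,0,0,0,2,0,1,0⟩, ⟨10,0,0,0,2,0,2,0⟩,
   ⟨10,0,0,0,2,0,2,1⟩, ⟨10,0,0,0,2,0,3,0⟩, ⟨10,0,0,0,2,0,3,1⟩, ⟨10,0,0,0,2,0,4,0⟩,
   ⟨10,1,0,0,2,1,1,0⟩, ⟨10,1,0,0,2,1,2,0⟩, ⟨10,2,0,4,2,1,0,0⟩, ⟨10,2,0,4,2,1,1,0⟩,
   ⟨10,4,16,1,2,1,0,1⟩, ⟨11,0,0,0,3,0,0,0⟩, ⟨11,0,0,0,3,0,0,4⟩, ⟨11,0,2,0,3,0,0,1⟩,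
   ⟨11,0,2,0,3,0,0,2⟩, ⟨11,1,2,0,3,1,0,1⟩, ⟨14,0,0,0,3,0,2,1⟩, ⟨14,0,0,0,3,0,3,0⟩,
   ⟨14,0,0,0,3,0,3,1⟩, ⟨14,0,0,0,3,0,4,0⟩, ⟨14,1,0,0,3,1,2,0⟩, ⟨14,1,0,2,3,1,1,0⟩,
   ⟨14,2,0,4,3,1,1,0⟩, ⟨14,2,8,0,3,1,0,1⟩, ⟨14,4,16,0,3,1,0,1⟩, ⟨15,0,0,0,4,0,0,0⟩,
   ⟨15,0,0,0,4,0,0,1⟩, ⟨15,0,1,0,4,0,0,0⟩, ⟨15,0,1,0,4,0,0,2⟩, ⟨15,0,2,0,4,0,0,1⟩,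
   ⟨15,0,2,0,4,0,0,2⟩, ⟨15,1,0,0,4,1,0,0⟩, ⟨15,1,0,2,4,1,0,0⟩, ⟨15,1,1,0,4,1,0,0⟩,
   ⟨15,1,2,0,4,1,0,1⟩, ⟨15,1,2,2,4,1,0,2⟩, ⟨15,2,0,4,4,1,0,0⟩, ⟨15,2,1,4,4,1,0,0⟩,
   ⟨15,2,2,4,4,1,0,2⟩, ⟨21,0,1,0,3,0,0,2⟩, ⟨21,1,1,0,3,1,0,0⟩, ⟨21,4,1,8,3,1,0,2⟩,
   ⟨23,0,1,0,4,0,0,0⟩, ⟨23,0,1,1,4,0,0,3⟩, ⟨23,1,1,1,4,1,0,3⟩, ⟨30,0,0,0,4,0,4,1⟩,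
   ⟨30,1,0,0,4,1,3,0⟩, ⟨30,2,0,0,4,1,2,0⟩, ⟨30,4,0,8,4,1,1,0⟩, ⟨30,8,32,0,4,1,0,1⟩,
   ⟨31,0,0,0,5,0,0,0⟩, ⟨31,0,0,0,5,0,0,1⟩, ⟨31,0,1,0,5,0,0,0⟩, ⟨31,0,1,0,5,0,0,2⟩,
   ⟨31,0,2,0,5,0,0,2⟩, ⟨31,1,0,0,5,1,0,0⟩, ⟨31,1,1,0,5,1,0,0⟩, ⟨31,1,2,0,5,1,0,1⟩,
   ⟨31,2,0,0,5,1,0,0⟩, ⟨31,2,1,0,5,1,0,0⟩, ⟨31,2,1,4,5,1,0,0⟩, ⟨31,2,2,0,5,1,0,1⟩,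
   ⟨31,4,0,8,5,1,0,0⟩, ⟨31,4,0,8,5,1,0,1⟩, ⟨31,4,1,8,5,1,0,0⟩, ⟨31,4,2,8,5,1,0,2⟩,
   ⟨42,1,0,0,3,1,4,0⟩, ⟨42,2,0,0,3,1,3,0⟩, ⟨42,4,0,0,3,1,2,1⟩, ⟨42,9,0,16,3,2,1,0⟩,
   ⟨42,18,64,4,3,2,0,0⟩, ⟨43,1,2,0,4,1,0,1⟩, ⟨43,2,2,0,4,1,0,2⟩, ⟨43,9,2,16,4,2,0,1⟩,
   ⟨46,0,0,0,4,0,2,1⟩, ⟨46,0,0,0,4,0,3,0⟩, ⟨46,0,0,0,4,0,3,2⟩, ⟨46,0,0,0,4,0,4,0⟩,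
   ⟨46,1,0,0,4,1,2,1⟩, ⟨46,1,0,2,4,1,1,0⟩, ⟨46,2,8,0,4,1,0,1⟩, ⟨46,3,0,2,4,2,1,0⟩,
   ⟨46,6,8,0,4,2,0,1⟩, ⟨47,0,2,0,5,0,0,1⟩, ⟨47,0,2,0,5,0,0,2⟩, ⟨47,0,2,0,5,0,0,3⟩,
   ⟨47,1,2,2,5,1,0,2⟩, ⟨47,3,2,2,5,2,0,2⟩, ⟨62,0,0,0,5,0,4,1⟩, ⟨62,1,0,0,5,1,3,0⟩,
   ⟨62,1,0,0,5,1,4,0⟩, ⟨62,2,0,0,5,1,2,0⟩, ⟨62,2,0,0,5,1,3,0⟩, ⟨62,4,0,0,5,1,2,0⟩,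
   ⟨62,4,0,8,5,1,1,0⟩, ⟨62,4,0,8,5,1,1,2⟩, ⟨62,8,0,16,5,1,1,0⟩, ⟨62,8,32,0,5,1,0,1⟩,
   ⟨62,8,32,0,5,1,0,2⟩, ⟨62,9,32,0,5,2,0,1⟩, ⟨62,16,64,0,5,1,0,1⟩, ⟨63,0,0,0,6,0,0,1⟩,
   ⟨63,0,1,0,6,0,0,2⟩, ⟨63,0,2,0,6,0,0,2⟩, ⟨63,1,0,0,6,1,0,0⟩, ⟨63,1,1,0,6,1,0,0⟩,
   ⟨63,1,2,0,6,1,0,1⟩, ⟨63,2,0,0,6,1,0,0⟩, ⟨63,2,1,0,6,1,0,0⟩, ⟨63,2,2,0,6,1,0,1⟩,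
   ⟨63,2,2,0,6,1,0,3⟩, ⟨63,4,0,0,6,1,0,0⟩, ⟨63,4,1,0,6,1,0,0⟩, ⟨63,4,1,0,6,1,0,2⟩,
   ⟨63,4,2,0,6,1,0,1⟩, ⟨63,4,2,8,6,1,0,2⟩, ⟨63,4,2,8,6,1,0,3⟩, ⟨63,8,0,16,6,1,0,0⟩,
   ⟨63,8,0,16,6,1,0,1⟩, ⟨63,8,1,16,6,1,0,0⟩, ⟨63,8,2,16,6,1,0,2⟩, ⟨63,9,1,16,6,2,0,0⟩,
   ⟨126,2,0,0,6,1,4,0⟩, ⟨126,4,0,0,6,1,3,0⟩, ⟨126,4,0,0,6,1,3,1⟩, ⟨126,8,0,0,6,1,2,0⟩,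
   ⟨126,9,0,0,6,2,2,0⟩, ⟨126,16,0,32,6,1,1,0⟩, ⟨126,18,0,32,6,2,1,0⟩, ⟨126,32,128,0,6,1,0,1⟩,
   ⟨126,36,128,8,6,2,0,2⟩, ⟨127,1,0,0,7,1,0,0⟩, ⟨127,1,1,0,7,1,0,0⟩, ⟨127,1,2,0,7,1,0,1⟩,
   ⟨127,2,0,0,7,1,0,0⟩, ⟨127,2,1,0,7,1,0,0⟩, ⟨127,2,2,0,7,1,0,1⟩, ⟨127,2,2,0,7,1,0,2⟩,
   ⟨127,4,0,0,7,1,0,0⟩, ⟨127,4,2,0,7,1,0,1⟩, ⟨127,8,0,0,7,1,0,0⟩, ⟨127,8,0,0,7,1,0,1⟩,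
   ⟨127,8,1,0,7,1,0,2⟩, ⟨127,8,2,0,7,1,0,1⟩, ⟨127,9,2,0,7,2,0,1⟩, ⟨127,16,0,32,7,1,0,0⟩,
   ⟨127,16,0,32,7,1,0,1⟩, ⟨127,16,2,32,7,1,0,2⟩, ⟨127,17,0,32,7,2,0,0⟩, ⟨127,17,1,32,7,2,0,0⟩,
   ⟨127,18,2,32,7,2,0,3⟩, ⟨254,4,0,0,7,1,4,0⟩, ⟨254,8,0,0,7,1,3,1⟩, ⟨254,17,0,0,7,2,2,0⟩,
   ⟨254,34,0,64,7,2,1,0⟩, ⟨254,68,256,0,7,2,0,1⟩, ⟨255,2,0,0,8,1,0,0⟩, ⟨255,2,1,0,8,1,0,0⟩,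
   ⟨255,2,2,0,8,1,0,1⟩, ⟨255,4,0,0,8,1,0,0⟩, ⟨255,4,2,0,8,1,0,2⟩, ⟨255,8,0,0,8,1,0,0⟩,
   ⟨255,8,1,0,8,1,0,2⟩, ⟨255,16,0,0,8,1,0,0⟩, ⟨255,16,0,0,8,1,0,1⟩, ⟨255,17,1,0,8,2,0,0⟩,
   ⟨255,17,2,0,8,2,0,1⟩, ⟨255,32,0,64,8,1,0,1⟩, ⟨255,33,0,64,8,2,0,0⟩, ⟨255,34,1,64,8,2,0,0⟩,
   ⟨255,34,2,64,8,2,0,2⟩, ⟨510,8,0,0,8,1,4,1⟩, ⟨510,17,0,0,8,2,3,0⟩, ⟨510,34,0,0,8,2,2,0⟩,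
   ⟨510,68,0,128,8,2,1,0⟩, ⟨510,136,512,0,8,2,0,1⟩, ⟨511,4,0,0,9,1,0,0⟩, ⟨511,4,1,0,9,1,0,0⟩,
   ⟨511,4,2,0,9,1,0,2⟩, ⟨511,8,0,0,9,1,0,0⟩, ⟨511,16,0,0,9,1,0,0⟩, ⟨511,16,0,0,9,1,0,1⟩,
   ⟨511,16,1,0,9,1,0,2⟩, ⟨511,17,2,0,9,2,0,1⟩, ⟨511,32,0,0,9,1,0,1⟩, ⟨511,33,0,0,9,2,0,0⟩,
   ⟨511,33,1,0,9,2,0,0⟩, ⟨511,34,2,0,9,2,0,1⟩, ⟨511,65,0,128,9,2,0,0⟩, ⟨511,66,0,128,9,2,0,0⟩,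
   ⟨511,66,1,128,9,2,0,0⟩, ⟨511,68,2,128,9,2,0,2⟩, ⟨1022,16,0,0,9,1,4,1⟩, ⟨1022,33,0,0,9,2,3,0⟩,
   ⟨1022,66,0,0,9,2,2,0⟩, ⟨1022,132,0,256,9,2,1,0⟩, ⟨1022,264,1024,0,9,2,0,1⟩,
   ⟨1023,8,0,0,10,1,0,0⟩, ⟨1023,8,2,0,10,1,0,2⟩, ⟨1023,16,0,0,10,1,0,0⟩, ⟨1023,16,1,0,10,1,0,2⟩,
   ⟨1023,32,0,0,10,1,0,1⟩, ⟨1023,33,1,0,10,2,0,0⟩, ⟨1023,33,2,0,10,2,0,1⟩,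
   ⟨1023,65,0,0,10,2,0,0⟩, ⟨1023,66,1,0,10,2,0,0⟩, ⟨1023,66,2,0,10,2,0,1⟩,
   ⟨1023,130,0,256,10,2,0,0⟩, ⟨1023,132,1,256,10,2,0,0⟩, ⟨1023,132,2,256,10,2,0,2⟩,
   ⟨2046,33,0,0,10,2,4,0⟩, ⟨2046,66,0,0,10,2,3,0⟩, ⟨2046,132,0,0,10,2,2,0⟩,
   ⟨2046,264,0,512,10,2,1,0⟩, ⟨2046,528,2048,0,10,2,0,1⟩, ⟨2047,16,0,0,11,1,0,0⟩,
   ⟨2047,32,0,0,11,1,0,1⟩, ⟨2047,32,1,0,11,1,0,2⟩, ⟨2047,33,2,0,11,2,0,1⟩,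
   ⟨2047,65,0,0,11,2,0,0⟩, ⟨2047,65,1,0,11,2,0,0⟩, ⟨2047,66,2,0,11,2,0,1⟩,
   ⟨2047,130,0,0,11,2,0,0⟩, ⟨2047,130,1,0,11,2,0,0⟩, ⟨2047,132,2,0,11,2,0,1⟩,
   ⟨2047,260,0,512,11,2,0,0⟩, ⟨2047,260,1,512,11,2,0,0⟩, ⟨2047,264,2,512,11,2,0,2⟩,
   ⟨4094,65,0,0,11,2,4,0⟩, ⟨4094,130,0,0,11,2,3,0⟩, ⟨4094,260,0,0,11,2,2,0⟩,
   ⟨4094,520,0,1024,11,2,1,0⟩, ⟨4094,1040,4096,0,11,2,0,1⟩, ⟨4095,32,1,0,12,1,0,2⟩,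
   ⟨4095,65,1,0,12,2,0,0⟩, ⟨4095,65,2,0,12,2,0,1⟩, ⟨4095,130,1,0,12,2,0,0⟩,
   ⟨4095,130,2,0,12,2,0,1⟩, ⟨4095,260,1,0,12,2,0,0⟩, ⟨4095,260,2,0,12,2,0,1⟩,
   ⟨4095,520,1,1024,12,2,0,0⟩, ⟨4095,520,2,1024,12,2,0,2⟩, ⟨8190,130,0,0,12,2,4,0⟩,
   ⟨8190,260,0,0,12,2,3,0⟩, ⟨8190,520,0,0,12,2,2,0⟩, ⟨8190,1040,0,2048,12,2,1,0⟩,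
   ⟨8190,2080,8192,0,12,2,0,1⟩, ⟨8191,65,2,0,13,2,0,1⟩, ⟨8191,130,2,0,13,2,0,1⟩,
   ⟨8191,260,2,0,13,2,0,1⟩, ⟨8191,520,2,0,13,2,0,1⟩, ⟨8191,1040,2,2048,13,2,0,2⟩]

theorem closed : (mR.all (good mR) && memb ⟨0, 0, 1, 0, 0, 0, 0, 0⟩ mR) = true := by
  decide +kernel

theorem closed_mem {s : MSt} (h : s ∈ mR) : good mR s = true := by
  have := closed
  rw [Bool.and_eq_true] at this
  exact List.all_eq_true.mp this.1 s h

theorem init_mem : (⟨0, 0, 1, 0, 0, 0, 0, 0⟩ : MSt) ∈ mR := by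
  have := closed
  rw [Bool.and_eq_true] at this
  exact mem_of_memb this.2

theorem good_bd {s : MSt} (h : s ∈ mR) : s.o ≤ 4 ∧ s.i ≤ 4 ∧ s.u ≤ 13 ∧ s.w ≤ 13 := by
  have := closed_mem h
  simp only [good, Bool.and_eq_true, Nat.ble_eq] at this
  tauto

theorem good_D {s : MSt} (h : s ∈ mR) (h0 : s.U.testBit 0 = true) :
    1 ≤ s.u ∧ b0 s.W ≤ s.w ∧ stepD s ∈ mR := by
  have := closed_mem h
  simp only [good, Bool.and_eq_true, Nat.ble_eq, bit_eq, h0, if_true] at this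
  exact ⟨this.2.1.1, this.2.1.2, mem_of_memb this.2.2⟩

theorem good_B {s : MSt} (h : s ∈ mR) (h0 : s.U.testBit 0 = false) (hi : s.i ≤ 3) :
    b0 s.W ≤ s.w ∧ stepB s ∈ mR := by
  have := closed_mem h
  simp only [good, Bool.and_eq_true, Nat.ble_eq, bit_eq, h0, hi, if_true] at this
  simp only [Bool.false_eq_true, if_false, Bool.and_eq_true, Nat.ble_eq] at this
  exact ⟨this.2.1.1, mem_of_memb this.2.1.2⟩

theorem good_A {s : MSt} (h : s ∈ mR) (h0 : s.U.testBit 0 = false) :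
    kk s ≤ 14 ∧ (blk s).testBit (kk s) = false ∧ stepA s (kk s) ∈ mR ∧
      b0 (s.W ||| 2 ^ kk s) ≤ s.w + 1 := by
  have := closed_mem h
  simp only [good, Bool.and_eq_true, Nat.ble_eq, bit_eq, h0] at this
  simp only [Bool.false_eq_true, if_false, Bool.and_eq_true, Nat.ble_eq, Bool.not_eq_true'] at this
  exact ⟨this.2.2.1.1.1, this.2.2.1.1.2, mem_of_memb this.2.2.1.2, this.2.2.2⟩

theorem kk_lt {s : MSt} {j : ℕ} (h : j < kk s) : (blk s).testBit j = true :=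
  fk_spec _ _ _ j (Nat.zero_le _) h

open Classical in
noncomputable def cA (x : ℕ) : ℕ := Nat.count (fun j => ¬ B j) x

open Classical in
noncomputable def cB (x : ℕ) : ℕ := Nat.count B x

theorem cA_succ_pos {x : ℕ} (h : ¬ B x) : cA (x + 1) = cA x + 1 := by
  simp [cA, Nat.count_succ, h]

theorem cA_succ_neg {x : ℕ} (h : B x) : cA (x + 1) = cA x := by
  simp [cA, Nat.count_succ, h]

theorem cB_succ_pos {x : ℕ} (h : B x) : cB (x + 1) = cB x + 1 := by
  simp [cB, Nat.count_succ, h]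

theorem cB_succ_neg {x : ℕ} (h : ¬ B x) : cB (x + 1) = cB x := by
  simp [cB, Nat.count_succ, h]

theorem cA_zero : cA 0 = 0 := by simp [cA]
theorem cB_zero : cB 0 = 0 := by simp [cB]

theorem cA_add_cB (x : ℕ) : cA x + cB x = x := by
  induction x with
  | zero => simp [cA_zero, cB_zero]
  | succ x ih =>
    by_cases h : B x
    · rw [cA_succ_neg h, cB_succ_pos h]; omega
    · rw [cA_succ_pos h, cB_succ_neg h]; omega

structure Inv (x d : ℕ) (s : MSt) : Prop where
  hx : 1 ≤ x
  hd : 1 ≤ d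
  low : ∀ c < d, ∃ i, i < x ∧ P i (i + c)
  hU : ∀ k, s.U.testBit k = true ↔ ∃ i, i < x ∧ P i (i + (d + k))
  hW : ∀ k, s.W.testBit k = true ↔ ∃ i, i < x ∧ P i (x + d + k)
  hM : ∀ k, s.M.testBit k = true ↔ ∃ i j, i + 1 = x ∧ j + 2 = x + d + k ∧ P i j
  hN : ∀ k, s.N.testBit k = true ↔ ∃ i j, i + 2 = x ∧ j + 1 = x + d + k ∧ P i j
  hA : cA x = d + s.u
  hB : cB (x + d) + s.w + 1 = cA x
  hi : ∀ m < s.i, ∃ j, j + m + 1 = x ∧ B j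
  ho : ∃ j, j + s.o + 1 = x + d ∧ ¬ B j
  no5 : ∀ j, j + 5 ≤ x + d → ∃ m < 5, ¬ B (j + m)
  mem : s ∈ mR

theorem B_fin {X D z : ℕ} (low : ∀ c < D, ∃ i, i < X ∧ P i (i + c)) (h1 : X ≤ z)
    (h2 : z < X + D) : B z ↔ ∃ i, i < X ∧ P i z := by
  constructor
  · rintro ⟨i, hi, hp⟩
    refine ⟨i, ?_, hp⟩
    by_contra hc
    obtain ⟨i', hi', hp'⟩ := low (z - i) (by omega)
    have hz : z = i + (z - i) := by omega
    rw [hz] at hp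
    have := P_diag' hp (by simpa using hp')
    omega
  · rintro ⟨i, hi, hp⟩
    exact ⟨i, by omega, hp⟩

theorem emit {n V o : ℕ} (hB : B n ↔ V % 2 = 1) (ho : ∃ j, j + o + 1 = n ∧ ¬ B j)
    (no5 : ∀ j, j + 5 ≤ n → ∃ m < 5, ¬ B (j + m)) (hr : run V o ≤ 4) :
    cB (n + 1) = cB n + b0 V ∧ (∃ j, j + run V o + 1 = n + 1 ∧ ¬ B j) ∧
      (∀ j, j + 5 ≤ n + 1 → ∃ m < 5, ¬ B (j + m)) := by
  by_cases h : B n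
  · have hv := hB.mp h
    have e : run V o = o + 1 := by simp [run, hv]
    rw [e] at hr ⊢
    obtain ⟨j, hj, hjB⟩ := ho
    refine ⟨by rw [cB_succ_pos h, b0, hv], ⟨j, by omega, hjB⟩, ?_⟩
    intro l hl
    by_cases hl' : l + 5 ≤ n
    · exact no5 l hl'
    · refine ⟨j - l, by omega, ?_⟩
      have : l + (j - l) = j := by omega
      rwa [this]
  · have hv : V % 2 = 0 := by
      have : ¬ V % 2 = 1 := fun hh => h (hB.mpr hh)
      omega
    have e : run V o = 0 := by simp [run, hv]
    rw [e]
    refine ⟨by rw [cB_succ_neg h, b0, hv, add_zero], ⟨n, by omega, h⟩, ?_⟩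
    intro l hl
    by_cases hl' : l + 5 ≤ n
    · exact no5 l hl'
    · refine ⟨4, by omega, ?_⟩
      have : l + 4 = n := by omega
      rwa [this]

theorem tb0 (V : ℕ) : V.testBit 0 = true ↔ V % 2 = 1 := by
  simp [Nat.testBit_zero]

theorem tb2 (V k : ℕ) : (V / 2).testBit k = V.testBit (k + 1) := by
  rw [Nat.testBit_succ]

theorem tb4 (V k : ℕ) : (V / 4).testBit k = V.testBit (k + 2) := by
  rw [Nat.testBit_succ, Nat.testBit_succ, Nat.div_div_eq_div_mul]

theorem tbor (V a k : ℕ) : (V ||| 2 ^ a).testBit k = true ↔ (V.testBit k = true ∨ a = k) := by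
  rw [Nat.testBit_or, Bool.or_eq_true, Nat.testBit_two_pow]
  simp

theorem inv_D {x d : ℕ} {s : MSt} (h : Inv x d s) (h0 : s.U.testBit 0 = true) :
    Inv x (d + 1) (stepD s) ∧ (stepD s).u + 1 = s.u := by
  obtain ⟨g1, g2, g3⟩ := good_D h.mem h0
  have hlow : ∀ c < d + 1, ∃ i, i < x ∧ P i (i + c) := by
    intro c hc
    rcases Nat.lt_succ_iff_lt_or_eq.mp hc with hc | hc
    · exact h.low c hc
    · subst hc; exact (h.hU 0).mp h0
  have hBn : B (x + d) ↔ s.W % 2 = 1 := by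
    rw [B_fin hlow (by omega) (by omega), ← tb0, h.hW]; simp
  obtain ⟨e1, e2, e3⟩ := emit hBn h.ho h.no5 (good_bd g3).1
  have hA := h.hA
  have hB := h.hB
  refine ⟨⟨h.hx, by omega, hlow, ?_, ?_, ?_, ?_, ?_, ?_, h.hi, e2, e3, g3⟩, ?_⟩
  · intro k
    simp only [stepD]
    rw [tb2, h.hU]
    have : d + (k + 1) = d + 1 + k := by omega
    rw [this]
  · intro k
    simp only [stepD]
    rw [tb2, h.hW]
    have : x + d + (k + 1) = x + (d + 1) + k := by omega
    rw [this]
  · intro k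
    simp only [stepD]
    rw [tb2, h.hM]
    have : x + d + (k + 1) = x + (d + 1) + k := by omega
    rw [this]
  · intro k
    simp only [stepD]
    rw [tb2, h.hN]
    have : x + d + (k + 1) = x + (d + 1) + k := by omega
    rw [this]
  · simp only [stepD]; omega
  · simp only [stepD]
    rw [← add_assoc, e1]; omega
  · simp only [stepD]; omega

theorem inv_B {x d : ℕ} {s : MSt} (h : Inv x d s) (h0 : s.U.testBit 0 = false) (hb : B x) :
    Inv (x + 1) d (stepB s) := by
  have hd := h.hd
  have hi3 : s.i ≤ 3 := by
    by_contra hc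
    obtain ⟨j, hj, -⟩ := h.hi 3 (by omega)
    obtain ⟨m, hm, hm2⟩ := h.no5 j (by omega)
    apply hm2
    by_cases h4 : m = 4
    · have : j + m = x := by omega
      rwa [this]
    · obtain ⟨j', hj', hB'⟩ := h.hi (3 - m) (by omega)
      have : j + m = j' := by omega
      rwa [this]
  obtain ⟨g2, g3⟩ := good_B h.mem h0 hi3
  have hno : ∀ y, x ≤ y → ¬ P x y := fun y hy => B_col hb hy
  have hlow : ∀ c < d, ∃ i, i < x + 1 ∧ P i (i + c) := by
    intro c hc
    obtain ⟨i, hi, hp⟩ := h.low c hc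
    exact ⟨i, by omega, hp⟩
  have hex : ∀ f : ℕ → ℕ, x ≤ f x → ((∃ i, i < x ∧ P i (f i)) ↔ (∃ i, i < x + 1 ∧ P i (f i))) := by
    intro f hf
    constructor
    · rintro ⟨i, hi, hp⟩; exact ⟨i, by omega, hp⟩
    · rintro ⟨i, hi, hp⟩
      refine ⟨i, ?_, hp⟩
      by_contra hc
      have : i = x := by omega
      subst this
      exact hno _ hf hp
  have hBn : B (x + d) ↔ s.W % 2 = 1 := by
    rw [B_fin hlow (by omega) (by omega), ← tb0, h.hW]
    exact (hex (fun _ => x + d) (by simp)).symm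
  obtain ⟨e1, e2, e3⟩ := emit hBn h.ho h.no5 (good_bd g3).1
  have hA := h.hA
  have hB := h.hB
  have exd : x + 1 + d = x + d + 1 := by omega
  refine ⟨by omega, hd, hlow, ?_, ?_, ?_, ?_, ?_, ?_, ?_, by rw [exd]; exact e2,
    by rw [exd]; exact e3, g3⟩
  · intro k
    simp only [stepB]
    rw [h.hU]
    exact hex (fun i => i + (d + k)) (by simp)
  · intro k
    simp only [stepB]
    rw [tb2, h.hW]
    have : x + 1 + d + k = x + d + (k + 1) := by omega
    rw [this]
    exact hex (fun i => x + d + (k + 1)) (by show x ≤ x + d + (k + 1); omega)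
  · intro k
    simp only [stepB]
    simp only [Nat.zero_testBit, Bool.false_eq_true, false_iff]
    rintro ⟨i, j, hi, hj, hp⟩
    have : i = x := by omega
    subst this
    exact hno j (by omega) hp
  · intro k
    simp only [stepB]
    rw [tb4, h.hM]
    constructor
    · rintro ⟨i, j, hi, hj, hp⟩; exact ⟨i, j, by omega, by omega, hp⟩
    · rintro ⟨i, j, hi, hj, hp⟩; exact ⟨i, j, by omega, by omega, hp⟩
  · simp only [stepB]; rw [cA_succ_neg hb]; exact hA
  · simp only [stepB]
    rw [exd, e1, cA_succ_neg hb]; omega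
  · intro m hm
    simp only [stepB] at hm
    rcases Nat.eq_zero_or_pos m with hm0 | hm0
    · exact ⟨x, by omega, hb⟩
    · obtain ⟨j, hj, hjB⟩ := h.hi (m - 1) (by omega)
      exact ⟨j, by omega, hjB⟩

theorem blk_iff (s : MSt) (k : ℕ) : (blk s).testBit k = true ↔
    (s.U.testBit k = true ∨ s.W.testBit k = true ∨ s.M.testBit k = true ∨
      s.N.testBit k = true) := by
  simp only [blk, Nat.testBit_or, Bool.or_eq_true]
  tauto

theorem col_blk {x d k : ℕ} {s : MSt} (h : Inv x d s) (hk : (blk s).testBit k = true) :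
    ¬ P x (x + d + k) := by
  intro hp
  rcases (blk_iff s k).mp hk with h1 | h1 | h1 | h1
  · obtain ⟨i, hi, hq⟩ := (h.hU k).mp h1
    rw [add_assoc] at hp
    have := P_diag' hq hp
    omega
  · obtain ⟨i, hi, hq⟩ := (h.hW k).mp h1
    exact P_row hq hp hi
  · obtain ⟨i, j, hi, hj, hq⟩ := (h.hM k).mp h1
    exact P_k1 hq hp hi hj
  · obtain ⟨i, j, hi, hj, hq⟩ := (h.hN k).mp h1
    exact P_k2 hq hp hi hj

theorem col_A {x d : ℕ} {s : MSt} (h : Inv x d s) (h0 : s.U.testBit 0 = false) (hb : ¬ B x) :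
    P x (x + d + kk s) := by
  obtain ⟨g0, g1, -, -⟩ := good_A h.mem h0
  have g1' : ¬ (blk s).testBit (kk s) = true := by rw [g1]; simp
  rw [blk_iff] at g1'
  push Not at g1'
  obtain ⟨n1, n2, n3, n4⟩ := g1'
  rw [Ne, h.hU] at n1
  rw [Ne, h.hW] at n2
  rw [Ne, h.hM] at n3
  rw [Ne, h.hN] at n4
  apply P_of
  · intro i hi hp; exact n2 ⟨i, hi, hp⟩
  · intro j hj hp
    rcases Nat.lt_or_ge j x with h1 | h1
    · exact hb ⟨j, h1, P_symm hp⟩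
    · rcases Nat.lt_or_ge j (x + d) with h2 | h2
      · obtain ⟨i, hi, hq⟩ := h.low (j - x) (by omega)
        have : j = x + (j - x) := by omega
        rw [this] at hp
        have := P_diag' hq (by simpa using hp)
        omega
      · have : j = x + d + (j - (x + d)) := by omega
        rw [this] at hp
        exact col_blk h (kk_lt (by omega)) hp
  · intro i j k hk h1 h2 hp
    refine n1 ⟨i, by omega, ?_⟩
    have : i + (d + kk s) = j := by omega
    rwa [this]
  · intro i j h1 h2 hp; exact n3 ⟨i, j, h1, h2, hp⟩
  · intro i j h1 h2 hp; exact n4 ⟨i, j, h1, h2, hp⟩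

theorem inv_A {x d : ℕ} {s : MSt} (h : Inv x d s) (h0 : s.U.testBit 0 = false) (hb : ¬ B x) :
    Inv (x + 1) d (stepA s (kk s)) := by
  have hP := col_A h h0 hb
  obtain ⟨g0, g1, g3, g2⟩ := good_A h.mem h0
  generalize kk s = K at *
  have hd := h.hd
  have huniq : ∀ y, P x y ↔ y = x + d + K := by
    intro y
    constructor
    · intro hy; exact P_col hy hP
    · rintro rfl; exact hP
  have hlow : ∀ c < d, ∃ i, i < x + 1 ∧ P i (i + c) := by
    intro c hc
    obtain ⟨i, hi, hp⟩ := h.low c hc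
    exact ⟨i, by omega, hp⟩
  have hex : ∀ f : ℕ → ℕ, ((∃ i, i < x ∧ P i (f i)) ∨ f x = x + d + K ↔
      (∃ i, i < x + 1 ∧ P i (f i))) := by
    intro f
    constructor
    · rintro (⟨i, hi, hp⟩ | h1)
      · exact ⟨i, by omega, hp⟩
      · exact ⟨x, by omega, (huniq _).mpr h1⟩
    · rintro ⟨i, hi, hp⟩
      by_cases hc : i < x
      · exact Or.inl ⟨i, hc, hp⟩
      · have : i = x := by omega
        subst this
        exact Or.inr ((huniq _).mp hp)
  have hBn : B (x + d) ↔ (s.W ||| 2 ^ K) % 2 = 1 := by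
    rw [B_fin hlow (by omega) (by omega), ← tb0, tbor, h.hW, ← hex (fun _ => x + d)]
    apply or_congr
    · rfl
    · omega
  obtain ⟨e1, e2, e3⟩ := emit hBn h.ho h.no5 (good_bd g3).1
  have hA := h.hA
  have hB := h.hB
  have exd : x + 1 + d = x + d + 1 := by omega
  refine ⟨by omega, hd, hlow, ?_, ?_, ?_, ?_, ?_, ?_, ?_, by rw [exd]; exact e2,
    by rw [exd]; exact e3, g3⟩
  · intro k
    simp only [stepA]
    rw [tbor, h.hU, ← hex (fun i => i + (d + k))]
    apply or_congr
    · rfl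
    · omega
  · intro k
    simp only [stepA]
    rw [tb2, tbor, h.hW]
    have : x + 1 + d + k = x + d + (k + 1) := by omega
    rw [this, ← hex (fun i => x + d + (k + 1))]
    apply or_congr
    · rfl
    · omega
  · intro k
    simp only [stepA]
    rw [Nat.testBit_two_pow]
    simp only [decide_eq_true_eq]
    constructor
    · intro hk
      exact ⟨x, x + d + K, rfl, by omega, hP⟩
    · rintro ⟨i, j, hi, hj, hp⟩
      have : i = x := by omega
      subst this
      have := (huniq j).mp hp
      omega
  · intro k
    simp only [stepA]
    rw [tb4, h.hM]
    constructor
    · rintro ⟨i, j, hi, hj, hp⟩; exact ⟨i, j, by omega, by omega, hp⟩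
    · rintro ⟨i, j, hi, hj, hp⟩; exact ⟨i, j, by omega, by omega, hp⟩
  · simp only [stepA]; rw [cA_succ_pos hb]; omega
  · simp only [stepA]
    rw [exd, e1, cA_succ_pos hb]; omega
  · intro m hm
    simp only [stepA] at hm
    omega

theorem inv_init : Inv 1 1 ⟨0, 0, 1, 0, 0, 0, 0, 0⟩ := by
  have h0 : ∀ y, P 0 y ↔ y = 0 := fun y =>
    ⟨fun h => P_col h P_00, fun h => by rw [h]; exact P_00⟩
  have hB0 : ¬ B 0 := by rintro ⟨i, hi, -⟩; omega
  have hB1 : ¬ B 1 := by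
    rintro ⟨i, hi, hp⟩
    have : i = 0 := by omega
    subst this
    have := (h0 1).mp hp
    omega
  have hcA : cA 1 = 1 + 0 := by
    have := cA_succ_pos hB0
    rw [cA_zero] at this
    simpa using this
  have hcB : cB (1 + 1) + 0 + 1 = cA 1 := by
    have e1 := cB_succ_neg hB1
    have e2 := cB_succ_neg hB0
    rw [cB_zero] at e2
    simp only [zero_add] at e2
    omega
  refine ⟨le_refl _, le_refl _, ?_, ?_, ?_, ?_, ?_, ?_, ?_, ?_, ⟨1, by simp, hB1⟩, ?_, init_mem⟩
  · intro c hc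
    have : c = 0 := by omega
    subst this
    exact ⟨0, by omega, P_00⟩
  · intro k
    simp only [Nat.zero_testBit, Bool.false_eq_true, false_iff]
    rintro ⟨i, hi, hp⟩
    have : i = 0 := by omega
    subst this
    have := (h0 _).mp hp
    omega
  · intro k
    simp only [Nat.zero_testBit, Bool.false_eq_true, false_iff]
    rintro ⟨i, hi, hp⟩
    have : i = 0 := by omega
    subst this
    have := (h0 _).mp hp
    omega
  · intro k
    have e : (1 : ℕ) = 2 ^ 0 := rfl
    simp only
    rw [show Nat.testBit 1 k = Nat.testBit (2 ^ 0) k from rfl, Nat.testBit_two_pow]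
    simp only [decide_eq_true_eq]
    constructor
    · intro hk
      exact ⟨0, 0, rfl, by omega, P_00⟩
    · rintro ⟨i, j, hi, hj, hp⟩
      have : i = 0 := by omega
      subst this
      have := (h0 _).mp hp
      omega
  · intro k
    simp only [Nat.zero_testBit, Bool.false_eq_true, false_iff]
    rintro ⟨i, j, hi, hj, hp⟩
    omega
  · exact hcA
  · exact hcB
  · intro m hm
    simp at hm
  · intro j hj; omega

theorem inv_n (n : ℕ) : ∃ x d s, x + d = n + 2 ∧ Inv x d s := by
  induction n with
  | zero => exact ⟨1, 1, _, rfl, inv_init⟩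
  | succ n ih =>
    obtain ⟨x, d, s, hn, h⟩ := ih
    cases h0 : s.U.testBit 0 with
    | true => exact ⟨x, d + 1, _, by omega, (inv_D h h0).1⟩
    | false =>
      by_cases hb : B x
      · exact ⟨x + 1, d, _, by omega, inv_B h h0 hb⟩
      · exact ⟨x + 1, d, _, by omega, inv_A h h0 hb⟩

theorem inv_norm : ∀ n x d s, s.u = n → Inv x d s →
    ∃ d' s', Inv x d' s' ∧ s'.U.testBit 0 = false := by
  intro n
  induction n with
  | zero =>
    intro x d s hn h
    cases h0 : s.U.testBit 0 with
    | true => have := (inv_D h h0).2; omega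
    | false => exact ⟨d, s, h, h0⟩
  | succ n ih =>
    intro x d s hn h
    cases h0 : s.U.testBit 0 with
    | true =>
      have := inv_D h h0
      exact ih x (d + 1) (stepD s) (by omega) this.1
    | false => exact ⟨d, s, h, h0⟩

theorem inv_x (x : ℕ) : ∃ d s, Inv (x + 1) d s ∧ s.U.testBit 0 = false := by
  induction x with
  | zero => exact inv_norm _ _ _ _ rfl inv_init
  | succ x ih =>
    obtain ⟨d, s, h, h0⟩ := ih
    by_cases hb : B (x + 1)
    · exact inv_norm _ _ _ _ rfl (inv_B h h0 hb)
    · exact inv_norm _ _ _ _ rfl (inv_A h h0 hb)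

theorem P_near {x y : ℕ} (h : P x y) (hxy : x ≤ y) : ∃ k l : ℕ, k ≤ 14 ∧ l ≤ 14 ∧
    y + l = x + cA x + k := by
  rcases Nat.eq_zero_or_pos x with h0 | h0
  · subst h0
    have := P_col h P_00
    exact ⟨0, 0, by omega, by omega, by rw [cA_zero]; omega⟩
  · obtain ⟨d, s, hi, hs⟩ := inv_x (x - 1)
    rw [Nat.sub_add_cancel h0] at hi
    have hb : ¬ B x := fun hb => B_col hb hxy h
    have hp := P_col h (col_A hi hs hb)
    obtain ⟨g0, -, -, -⟩ := good_A hi.mem hs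
    have := (good_bd hi.mem)
    have hA := hi.hA
    exact ⟨kk s, s.u, g0, by omega, by omega⟩

theorem cA_rec (n : ℕ) (hn : 2 ≤ n) : ∃ x u w : ℕ, x < n ∧ u ≤ 13 ∧ w ≤ 14 ∧
    x + cA x = n + u ∧ cA n + cA x = n + w := by
  obtain ⟨x, d, s, e, h⟩ := inv_n (n - 2)
  have e' : x + d = n := by omega
  have b := good_bd h.mem
  have h1 := h.hA
  have h2 := h.hB
  have h3 := h.hd
  have h4 := cA_add_cB n
  rw [e'] at h2
  exact ⟨x, s.u, s.w + 1, by omega, by omega, by omega, by omega, by omega⟩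

theorem phi_sq : phi * phi = phi + 1 := by
  have h := Real.mul_self_sqrt (show (0 : ℝ) ≤ 5 by norm_num)
  unfold phi
  nlinarith

theorem phi_gt : 3 / 2 < phi := by
  have h : (2 : ℝ) < Real.sqrt 5 := by
    rw [Real.lt_sqrt (by norm_num)]; norm_num
  unfold phi
  linarith

theorem phi_lt : phi < 2 := by
  have h : Real.sqrt 5 < 3 := by
    rw [Real.sqrt_lt' (by norm_num)]; norm_num
  unfold phi
  linarith

theorem cA_bd : ∀ n : ℕ, |(cA n : ℝ) - (phi - 1) * n| ≤ 200 := by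
  intro n
  induction n using Nat.strong_induction_on with
  | _ n ih =>
    have p1 := phi_sq
    have p2 := phi_gt
    have p3 := phi_lt
    rcases Nat.lt_or_ge n 2 with hn | hn
    · have h4 := cA_add_cB n
      have a1 : (cA n : ℝ) ≤ 2 := by exact_mod_cast (by omega : cA n ≤ 2)
      have a2 : (0 : ℝ) ≤ cA n := Nat.cast_nonneg _
      have a3 : (n : ℝ) ≤ 2 := by exact_mod_cast (by omega : n ≤ 2)
      have a4 : (0 : ℝ) ≤ n := Nat.cast_nonneg _
      rw [abs_le]
      constructor <;> nlinarith
    · obtain ⟨x, u, w, hx, hu, hw, e1, e2⟩ := cA_rec n hn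
      have ih := ih x hx
      have e1' : (x : ℝ) + cA x = n + u := by exact_mod_cast e1
      have e2' : (cA n : ℝ) + cA x = n + w := by exact_mod_cast e2
      have u1 : (u : ℝ) ≤ 13 := by exact_mod_cast hu
      have w1 : (w : ℝ) ≤ 14 := by exact_mod_cast hw
      have u0 : (0 : ℝ) ≤ u := Nat.cast_nonneg _
      have w0 : (0 : ℝ) ≤ w := Nat.cast_nonneg _
      have key : (cA n : ℝ) - (phi - 1) * n =
          -(phi - 1) * ((cA x : ℝ) - (phi - 1) * x) + w - (2 - phi) * u := by
        have en : (n : ℝ) = x + cA x - u := by linarith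
        have ec : (cA n : ℝ) = n + w - cA x := by linarith
        rw [ec, en]
        linear_combination (-(x : ℝ)) * p1
      rw [key]
      generalize (cA x : ℝ) - (phi - 1) * x = t at ih
      have p4 : phi < 1.7 := by nlinarith
      rw [abs_le] at ih ⊢
      constructor <;> nlinarith

end Mah

theorem maharaja_P_positions_near_golden_line :
    ∃ C : ℝ, 0 < C ∧ ∀ x y : ℕ, MahP (x, y) → x ≤ y → |(y : ℝ) - phi * x| ≤ C := by
  refine ⟨300, by norm_num, ?_⟩
  intro x y h hxy
  obtain ⟨k, l, hk, hl, e⟩ := Mah.P_near h hxy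
  have hb := Mah.cA_bd x
  have e' : (y : ℝ) + l = x + Mah.cA x + k := by exact_mod_cast e
  have k1 : (k : ℝ) ≤ 14 := by exact_mod_cast hk
  have l1 : (l : ℝ) ≤ 14 := by exact_mod_cast hl
  have k0 : (0 : ℝ) ≤ k := Nat.cast_nonneg _
  have l0 : (0 : ℝ) ≤ l := Nat.cast_nonneg _
  rw [abs_le] at hb ⊢
  constructor <;> linarith
end

section
/- A position (x, y) of Wythoff Nim with y ≥ x is a P-position if and only if there exists n ∈ ℕ with x = ⌊φ·n⌋ and y = ⌊φ²·n⌋, where φ = (1 + √5)/2 is the golden ratio. -/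
/-- One move of Wythoff Nim: from `p` to `q` by a Nim move (decrease one
coordinate by a positive amount) or a diagonal move (decrease both
coordinates by the same positive amount). -/
def WyMove (p q : ℕ × ℕ) : Prop :=
  (∃ k, 0 < k ∧ q.1 + k = p.1 ∧ q.2 = p.2) ∨
  (∃ k, 0 < k ∧ q.1 = p.1 ∧ q.2 + k = p.2) ∨
  (∃ k, 0 < k ∧ q.1 + k = p.1 ∧ q.2 + k = p.2)

theorem WyMove.lt {p q : ℕ × ℕ} (h : WyMove p q) : q.1 + q.2 < p.1 + p.2 := by
  rcases h with ⟨k, hk, h1, h2⟩ | ⟨k, hk, h1, h2⟩ | ⟨k, hk, h1, h2⟩ <;> omega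

/-- The P-positions of Wythoff Nim: `p` is P iff every move from `p` leads to
a non-P position. -/
def WyP (p : ℕ × ℕ) : Prop :=
  ∀ q, WyMove p q → ¬ WyP q
termination_by p.1 + p.2
decreasing_by exact WyMove.lt ‹_›

lemma phi_eq_gold : phi = Real.goldenRatio := rfl

noncomputable def wa (n : ℕ) : ℕ := ⌊phi * n⌋₊

lemma wa_cast (n : ℕ) : (wa n : ℤ) = ⌊phi * n⌋ := by
  unfold wa
  rw [Int.natCast_floor_eq_floor]
  rw [phi_eq_gold]
  have := Real.goldenRatio_pos
  positivity

lemma wb_cast (n : ℕ) : ((wa n + n : ℕ) : ℤ) = ⌊phi ^ 2 * n⌋ := by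
  have h : phi ^ 2 * n = phi * n + n := by
    rw [phi_eq_gold, Real.goldenRatio_sq]; ring
  rw [h, Int.floor_add_natCast, ← wa_cast]; push_cast; rfl

lemma wa_zero : wa 0 = 0 := by simp [wa]

lemma wa_strictMono : StrictMono wa := by
  apply strictMono_nat_of_lt_succ
  intro n
  have h1 := Real.one_lt_goldenRatio
  have : ((wa n : ℤ) + 1) ≤ wa (n+1) := by
    rw [wa_cast, wa_cast, Int.le_floor]
    have := Int.floor_le (phi * n)
    rw [phi_eq_gold] at *
    push_cast
    linarith
  omega

lemma phi_conj : phi.HolderConjugate (phi ^ 2) := by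
  have h1 := Real.one_lt_goldenRatio
  have h2 := Real.goldenRatio_sq
  rw [phi_eq_gold, Real.holderConjugate_iff]
  refine ⟨h1, ?_⟩
  generalize Real.goldenRatio = g at h1 h2
  have hg : g ≠ 0 := by positivity
  field_simp
  linarith

lemma ray (m : ℕ) (hm : 0 < m) :
    ((∃ n, 0 < n ∧ m = wa n) ∨ (∃ n, 0 < n ∧ m = wa n + n)) ∧
    ¬ ((∃ n, 0 < n ∧ m = wa n) ∧ (∃ n, 0 < n ∧ m = wa n + n)) := by
  have h := Irrational.beattySeq_symmDiff_beattySeq_pos (r := phi) (s := phi ^ 2)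
    phi_conj Real.goldenRatio_irrational
  have e1 : (∃ n, 0 < n ∧ m = wa n) ↔ (m : ℤ) ∈ {x | ∃ k > 0, beattySeq phi k = x} := by
    constructor
    · rintro ⟨n, hn, rfl⟩
      exact ⟨n, by exact_mod_cast hn, by simp [beattySeq, wa_cast, mul_comm]⟩
    · rintro ⟨k, hk, h⟩
      lift k to ℕ using hk.le
      refine ⟨k, by exact_mod_cast hk, ?_⟩
      zify
      rw [← h, wa_cast]
      simp [beattySeq, mul_comm]
  have e2 : (∃ n, 0 < n ∧ m = wa n + n) ↔
      (m : ℤ) ∈ {x | ∃ k > 0, beattySeq (phi ^ 2) k = x} := by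
    constructor
    · rintro ⟨n, hn, rfl⟩
      exact ⟨n, by exact_mod_cast hn, by rw [wb_cast]; simp [beattySeq, mul_comm]⟩
    · rintro ⟨k, hk, h⟩
      lift k to ℕ using hk.le
      refine ⟨k, by exact_mod_cast hk, ?_⟩
      apply Nat.cast_injective (R := ℤ)
      rw [← h, wb_cast]
      simp [beattySeq, mul_comm]
  have h3 : (m : ℤ) ∈ {n : ℤ | 0 < n} := by simpa using hm
  rw [← h, Set.mem_symmDiff, ← e1, ← e2] at h3
  clear e1 e2 h
  generalize (∃ n, 0 < n ∧ m = wa n) = A at *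
  generalize (∃ n, 0 < n ∧ m = wa n + n) = B at *
  tauto

def WQ (p : ℕ × ℕ) : Prop :=
  ∃ n, (p.1 = wa n ∧ p.2 = wa n + n) ∨ (p.2 = wa n ∧ p.1 = wa n + n)

lemma wa_coll {n m : ℕ} (h : wa n = wa m + m) : n = 0 ∧ m = 0 := by
  have h0 := wa_zero
  rcases Nat.eq_zero_or_pos m with rfl | hm
  · exact ⟨wa_strictMono.injective (by simpa using h), rfl⟩
  · rcases Nat.eq_zero_or_pos n with rfl | hn
    · omega
    · exact absurd ⟨⟨n, hn, rfl⟩, ⟨m, hm, h⟩⟩ (ray (wa n) (by omega)).2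

lemma WQ_swap {x y : ℕ} (h : WQ (x, y)) : WQ (y, x) := by
  obtain ⟨n, h⟩ := h
  exact ⟨n, h.symm⟩

lemma WQ_fun {x y z : ℕ} (h : WQ (x, y)) (h' : WQ (x, z)) : y = z := by
  obtain ⟨n, h⟩ := h
  obtain ⟨m, h'⟩ := h'
  simp only at h h'
  rcases h with ⟨h1, h2⟩ | ⟨h1, h2⟩ <;> rcases h' with ⟨h3, h4⟩ | ⟨h3, h4⟩
  · have := wa_strictMono.injective (h1.symm.trans h3)
    subst this; omega
  · have := wa_coll (h1.symm.trans h4)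
    obtain ⟨rfl, rfl⟩ := this; omega
  · have := wa_coll (h3.symm.trans h2)
    obtain ⟨rfl, rfl⟩ := this; omega
  · rcases lt_trichotomy n m with h | rfl | h
    · have := wa_strictMono h; omega
    · omega
    · have := wa_strictMono h; omega

lemma WQ_diag {x y k : ℕ} (h : WQ (x, y)) (h' : WQ (x + k, y + k)) : k = 0 := by
  obtain ⟨n, h⟩ := h
  obtain ⟨m, h'⟩ := h'
  simp only at h h'
  have : n = m := by omega
  subst this
  omega

lemma WQ_not_move {p q : ℕ × ℕ} (h : WQ p) (hm : WyMove p q) : ¬ WQ q := by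
  intro h'
  obtain ⟨x, y⟩ := p
  obtain ⟨u, v⟩ := q
  rcases hm with ⟨k, hk, h1, h2⟩ | ⟨k, hk, h1, h2⟩ | ⟨k, hk, h1, h2⟩ <;> simp only at h1 h2
  · subst h2
    have := WQ_fun (WQ_swap h) (WQ_swap h'); omega
  · subst h1
    have := WQ_fun h h'; omega
  · subst h1 h2
    have := WQ_diag h' h; omega

lemma WQ_exists_le {x y : ℕ} (hxy : x ≤ y) (h : ¬ WQ (x, y)) :
    ∃ q, WyMove (x, y) q ∧ WQ q := by
  have h0 := wa_zero
  have hx : (∃ n, x = wa n) ∨ ∃ n, 0 < n ∧ x = wa n + n := by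
    rcases Nat.eq_zero_or_pos x with rfl | hx
    · exact Or.inl ⟨0, h0.symm⟩
    · rcases (ray x hx).1 with ⟨n, _, hn⟩ | hn
      · exact Or.inl ⟨n, hn⟩
      · exact Or.inr hn
  rcases hx with ⟨n, rfl⟩ | ⟨n, hn, rfl⟩
  · rcases lt_trichotomy y (wa n + n) with hy | rfl | hy
    · obtain ⟨d, rfl⟩ := Nat.exists_eq_add_of_le hxy
      have hd : wa d < wa n := wa_strictMono (by omega)
      exact ⟨(wa d, wa d + d), Or.inr (Or.inr ⟨wa n - wa d, by omega, by simp only; omega,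
        by simp only; omega⟩), d, Or.inl ⟨rfl, rfl⟩⟩
    · exact absurd ⟨n, Or.inl ⟨rfl, rfl⟩⟩ h
    · exact ⟨(wa n, wa n + n), Or.inr (Or.inl ⟨y - (wa n + n), by omega, rfl,
        by simp only; omega⟩), n, Or.inl ⟨rfl, rfl⟩⟩
  · exact ⟨(wa n + n, wa n), Or.inr (Or.inl ⟨y - wa n, by omega, rfl,
        by simp only; omega⟩), n, Or.inr ⟨rfl, rfl⟩⟩

lemma WyMove_swap {p q : ℕ × ℕ} (h : WyMove p q) : WyMove p.swap q.swap := by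
  rcases h with ⟨k, hk, h1, h2⟩ | ⟨k, hk, h1, h2⟩ | ⟨k, hk, h1, h2⟩
  · exact Or.inr (Or.inl ⟨k, hk, h2, h1⟩)
  · exact Or.inl ⟨k, hk, h2, h1⟩
  · exact Or.inr (Or.inr ⟨k, hk, h2, h1⟩)

lemma WQ_exists {p : ℕ × ℕ} (h : ¬ WQ p) : ∃ q, WyMove p q ∧ WQ q := by
  obtain ⟨x, y⟩ := p
  rcases le_total x y with hxy | hxy
  · exact WQ_exists_le hxy h
  · obtain ⟨q, h1, h2⟩ := WQ_exists_le hxy (fun h' => h (WQ_swap h'))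
    exact ⟨q.swap, WyMove_swap h1, WQ_swap h2⟩

lemma WyP_iff_WQ (N : ℕ) : ∀ p : ℕ × ℕ, p.1 + p.2 = N → (WyP p ↔ WQ p) := by
  induction N using Nat.strong_induction_on with
  | _ N ih =>
    intro p hp
    rw [WyP]
    constructor
    · intro h
      by_contra hQ
      obtain ⟨q, hm, hq⟩ := WQ_exists hQ
      exact h q hm ((ih _ (hp ▸ hm.lt) q rfl).2 hq)
    · intro h q hm hq
      exact WQ_not_move h hm ((ih _ (hp ▸ hm.lt) q rfl).1 hq)

theorem wythoff_P_positions_characterization (x y : ℕ) (hxy : x ≤ y) :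
    WyP (x, y) ↔ ∃ n : ℕ, (x : ℤ) = ⌊phi * n⌋ ∧ (y : ℤ) = ⌊phi ^ 2 * n⌋ := by
  rw [WyP_iff_WQ _ (x, y) rfl]
  simp only [← wa_cast, ← wb_cast, Nat.cast_inj]
  constructor
  · rintro ⟨n, ⟨h1, h2⟩ | ⟨h1, h2⟩⟩
    · exact ⟨n, h1, h2⟩
    · simp only at h1 h2
      exact ⟨n, by omega, by omega⟩
  · rintro ⟨n, h⟩
    exact ⟨n, Or.inl h⟩
end

section
/- In Wythoff Nim, for every k ∈ ℕ there is exactly one y ∈ ℕ such that (k, y) is a P-position, and exactly one x ∈ ℕ such that (x, k) is a P-position. -/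
theorem wy_uniq (k y z : ℕ) (h1 : WyP (k, y)) (h2 : WyP (k, z)) : y = z := by
  rcases lt_trichotomy y z with h | h | h
  · rw [WyP] at h2
    exact absurd h1 (h2 _ (Or.inr (Or.inl ⟨z - y, by omega, rfl, by simp; omega⟩)))
  · exact h
  · rw [WyP] at h1
    exact absurd h2 (h1 _ (Or.inr (Or.inl ⟨y - z, by omega, rfl, by simp; omega⟩)))

theorem wy_swap (n : ℕ) : ∀ x y : ℕ, x + y = n → WyP (x, y) → WyP (y, x) := by
  induction n using Nat.strong_induction_on with
  | _ n ih =>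
    intro x y hn h
    rw [WyP] at h ⊢
    rintro ⟨a, b⟩ hm hP
    have hl := hm.lt
    simp only at hl
    have hP' := ih (a + b) (by omega) a b rfl hP
    refine h (b, a) ?_ hP'
    rcases hm with ⟨j, hj, h1, h2⟩ | ⟨j, hj, h1, h2⟩ | ⟨j, hj, h1, h2⟩
    · exact Or.inr (Or.inl ⟨j, hj, h2, h1⟩)
    · exact Or.inl ⟨j, hj, h2, h1⟩
    · exact Or.inr (Or.inr ⟨j, hj, h2, h1⟩)

theorem wy_exists (k : ℕ) : ∃ y, WyP (k, y) := by
  by_contra hcon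
  push Not at hcon
  have key : ∀ y : ℕ, ∃ c : Fin k × Bool,
      (c.2 = true → WyP (c.1.1, y)) ∧
      (c.2 = false → ∃ z, WyP (c.1.1, z) ∧ z + (k - c.1.1) = y) := by
    intro y
    have h := hcon y
    rw [WyP] at h
    push Not at h
    obtain ⟨⟨a, b⟩, hm, hP⟩ := h
    rcases hm with ⟨j, hj, h1, h2⟩ | ⟨j, hj, h1, h2⟩ | ⟨j, hj, h1, h2⟩ <;> simp only at h1 h2
    · subst h2
      exact ⟨(⟨a, by omega⟩, true), fun _ => hP, by simp⟩
    · subst h1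
      exact absurd hP (hcon b)
    · exact ⟨(⟨a, by omega⟩, false), by simp, fun _ => ⟨b, hP, by simp only; omega⟩⟩
  choose f hf using key
  refine not_injective_infinite_finite f ?_
  intro y y' he
  have h1 := hf y
  have h2 := hf y'
  rw [← he] at h2
  cases hb : (f y).2 with
  | true => exact wy_uniq _ _ _ (h1.1 hb) (h2.1 hb)
  | false =>
    obtain ⟨z, hz, e⟩ := h1.2 hb
    obtain ⟨z', hz', e'⟩ := h2.2 hb
    have := wy_uniq _ _ _ hz hz'
    omega

theorem wythoff_row_column_unique (k : ℕ) :
    (∃! y : ℕ, WyP (k, y)) ∧ (∃! x : ℕ, WyP (x, k)) := by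
  obtain ⟨y, hy⟩ := wy_exists k
  exact ⟨⟨y, hy, fun z hz => wy_uniq k z y hz hy⟩,
    ⟨y, wy_swap _ _ _ rfl hy, fun z hz => wy_uniq k z y (wy_swap _ _ _ rfl hz) hy⟩⟩
end

section
/- Let a : ℕ → ℕ be the strictly increasing enumeration of the set {x ∈ ℕ : ∃ y ≥ x, (x, y) is a P-position of Wythoff Nim}, and for each i let b_i ≥ a_i be the (unique) number such that (a_i, b_i) is a P-position. Then for every n ∈ ℕ, the set {b_i − a_i : 0 ≤ i ≤ n} equals {0, 1, …, n}. -/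
theorem wyP_iff (p : ℕ × ℕ) : WyP p ↔ ∀ q, WyMove p q → ¬ WyP q := by
  rw [WyP]

theorem wyP_col {x y z : ℕ} (h1 : WyP (x, y)) (h2 : WyP (x, z)) : y = z := by
  rcases lt_trichotomy y z with h | h | h
  · exact absurd h1 ((wyP_iff _).1 h2 _ (Or.inr (Or.inl ⟨z - y, by omega, rfl, by simp; omega⟩)))
  · exact h
  · exact absurd h2 ((wyP_iff _).1 h1 _ (Or.inr (Or.inl ⟨y - z, by omega, rfl, by simp; omega⟩)))

theorem wyP_diff (a b : ℕ → ℕ)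
    (ha_mono : StrictMono a)
    (ha_range : ∀ x : ℕ, (∃ i, a i = x) ↔ ∃ y : ℕ, x ≤ y ∧ WyP (x, y))
    (hb : ∀ i : ℕ, a i ≤ b i ∧ WyP (a i, b i)) (n : ℕ) : b n = a n + n := by
  induction n using Nat.strong_induction_on with
  | _ n ih =>
    have hn := hb n
    rcases lt_trichotomy (b n) (a n + n) with h | h | h
    · exfalso
      obtain ⟨i, hi⟩ : ∃ i, i = b n - a n := ⟨_, rfl⟩
      have hin : i < n := by omega
      have h1 := ih i hin
      have h2 := ha_mono hin
      exact (wyP_iff _).1 hn.2 (a i, b i)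
        (Or.inr (Or.inr ⟨a n - a i, by omega, by simp; omega, by simp; omega⟩)) (hb i).2
    · exact h
    · exfalso
      have hlow : ∀ x y, x < a n → x ≤ y → WyP (x, y) → ∃ i, i < n ∧ a i = x ∧ y = x + i := by
        intro x y hx hxy hP
        obtain ⟨i, rfl⟩ := (ha_range x).2 ⟨y, hxy, hP⟩
        have hin := ha_mono.lt_iff_lt.1 hx
        have := wyP_col hP (hb i).2
        exact ⟨i, hin, rfl, by rw [this, ih i hin]⟩
      refine (wyP_iff _).1 hn.2 (a n, a n + n)
        (Or.inr (Or.inl ⟨b n - (a n + n), by omega, rfl, by simp; omega⟩)) ?_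
      rw [wyP_iff]
      rintro ⟨x, y⟩ hm hP
      rcases hm with ⟨k, hk, h1, h2⟩ | ⟨k, hk, h1, h2⟩ | ⟨k, hk, h1, h2⟩ <;>
        simp only at h1 h2
      · obtain ⟨i, hi, _, _⟩ := hlow x y (by omega) (by omega) hP
        omega
      · subst h1
        have := wyP_col hP hn.2
        omega
      · obtain ⟨i, hi, _, _⟩ := hlow x y (by omega) (by omega) hP
        omega

theorem wythoff_differences_enumerate (a b : ℕ → ℕ)
    (ha_mono : StrictMono a)
    (ha_range : ∀ x : ℕ, (∃ i, a i = x) ↔ ∃ y : ℕ, x ≤ y ∧ WyP (x, y))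
    (hb : ∀ i : ℕ, a i ≤ b i ∧ WyP (a i, b i)) :
    ∀ n : ℕ, (Finset.range (n + 1)).image (fun i => b i - a i) = Finset.range (n + 1) := by
  intro n
  have : (fun i => b i - a i) = id := by
    funext i
    simp [wyP_diff a b ha_mono ha_range hb i]
  rw [this, Finset.image_id]
end

section
/- (Central Lemma.) Let x, y be complementary sequences of positive integers (indexed by n ≥ 1) with x strictly increasing, and suppose there are a real δ > 0 and a constant C such that |y_n − x_n − δ·n| ≤ C for all n. Then there exist real constants α, β with 1 < α < 2 < β and a constant C′ such that |x_n − α·n| ≤ C′ and |y_n − β·n| ≤ C′ for all n. -/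
open Finset in
theorem aux_count (X Y : ℕ → ℕ) (hX : StrictMono X) (hX0 : X 0 = 0)
    (hYi : ∀ m n, 1 ≤ m → 1 ≤ n → Y m = Y n → m = n)
    (hY1 : ∀ m, 1 ≤ m → 1 ≤ Y m)
    (hd : ∀ m n, 1 ≤ m → 1 ≤ n → X m ≠ Y n)
    (hcov : ∀ k, 1 ≤ k → (∃ n, 1 ≤ n ∧ X n = k) ∨ (∃ n, 1 ≤ n ∧ Y n = k)) :
    ∃ b : ℕ → ℕ, (∀ n, b (X n) + n = X n) ∧
      (∀ t, 1 ≤ b t → ∃ m, b t ≤ m ∧ Y m ≤ t) ∧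
      (∀ t, ∃ m, 1 ≤ m ∧ m ≤ b t + 1 ∧ t < Y m) := by
  classical
  let B : ℕ → Finset ℕ := fun t => (Icc 1 t).filter (fun k => ∃ m, 1 ≤ m ∧ Y m = k)
  have hB : ∀ t k, k ∈ B t ↔ (1 ≤ k ∧ k ≤ t) ∧ ∃ m, 1 ≤ m ∧ Y m = k := by
    intro t k; simp [B]
  refine ⟨fun t => (B t).card, ?_, ?_, ?_⟩
  · intro n
    have h1 : Icc 1 (X n) = B (X n) ∪ (Icc 1 n).image X := by
      ext k
      simp only [mem_union, hB, mem_image, mem_Icc]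
      constructor
      · rintro ⟨h1, h2⟩
        rcases hcov k h1 with ⟨m, hm, rfl⟩ | h
        · exact Or.inr ⟨m, ⟨hm, hX.le_iff_le.1 h2⟩, rfl⟩
        · exact Or.inl ⟨⟨h1, h2⟩, h⟩
      · rintro (h | ⟨m, ⟨h1, h2⟩, rfl⟩)
        · exact h.1
        · exact ⟨h1.trans hX.le_apply, hX.monotone h2⟩
    have h2 : Disjoint (B (X n)) ((Icc 1 n).image X) := by
      rw [Finset.disjoint_left]
      intro k hk hk'
      obtain ⟨_, m, hm, h⟩ := (hB _ _).1 hk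
      obtain ⟨m', hm', h'⟩ := mem_image.1 hk'
      exact hd m' m (mem_Icc.1 hm').1 hm (h'.trans h.symm)
    have h3 := congrArg card h1
    rw [card_union_of_disjoint h2, card_image_of_injective _ hX.injective] at h3
    simp at h3
    exact h3.symm
  · intro t ht
    by_contra! hcon
    have hs : B t ⊆ (Icc 1 ((B t).card - 1)).image Y := by
      intro k hk
      obtain ⟨⟨_, h2⟩, m, hm, rfl⟩ := (hB _ _).1 hk
      refine mem_image.2 ⟨m, mem_Icc.2 ⟨hm, ?_⟩, rfl⟩
      by_contra hlt
      have := hcon m (by simp only at *; omega)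
      omega
    have h1 := (card_le_card hs).trans card_image_le
    simp at h1 ht
    have := card_pos.2 ht
    omega
  · intro t
    by_contra! hcon
    have hs : (Icc 1 ((B t).card + 1)).image Y ⊆ B t := by
      intro k hk
      obtain ⟨m, hm, rfl⟩ := mem_image.1 hk
      have hm := mem_Icc.1 hm
      exact (hB _ _).2 ⟨⟨hY1 m hm.1, hcon m hm.1 hm.2⟩, m, hm.1, rfl⟩
    have h1 := card_le_card hs
    rw [card_image_of_injOn] at h1
    · simp at h1
    · intro a ha c hc h
      simp only [coe_Icc, Set.mem_Icc] at ha hc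
      exact hYi a c ha.1 hc.1 h

theorem aux_alpha (δ : ℝ) (hδ : 0 < δ) :
    ∃ α : ℝ, 1 < α ∧ α < 2 ∧ 2 < α + δ ∧ (α + δ) * (α - 1) = α := by
  have h0 : 0 ≤ 4 + δ ^ 2 := by positivity
  have hs := Real.sq_sqrt h0
  have hp := Real.sqrt_nonneg (4 + δ ^ 2)
  set s := Real.sqrt (4 + δ ^ 2)
  refine ⟨(2 - δ + s) / 2, ?_, ?_, ?_, ?_⟩ <;> nlinarith

theorem aux_main (X Y : ℕ → ℕ) (hX : StrictMono X) (hX0 : X 0 = 0)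
    (hYi : ∀ m n, 1 ≤ m → 1 ≤ n → Y m = Y n → m = n)
    (hY1 : ∀ m, 1 ≤ m → 1 ≤ Y m)
    (hd : ∀ m n, 1 ≤ m → 1 ≤ n → X m ≠ Y n)
    (hcov : ∀ k, 1 ≤ k → (∃ n, 1 ≤ n ∧ X n = k) ∨ (∃ n, 1 ≤ n ∧ Y n = k))
    (δ C : ℝ) (hδ : 0 < δ)
    (hC : ∀ n, 1 ≤ n → |(Y n : ℝ) - X n - δ * n| ≤ C)
    (α : ℝ) (h1 : 1 < α) (h2 : α < 2) (h3 : 2 < α + δ) (h4 : (α + δ) * (α - 1) = α) :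
    ∃ M : ℝ, ∀ n : ℕ, |(X n : ℝ) - α * n| ≤ M := by
  obtain ⟨b, hb, hup, hlo⟩ := aux_count X Y hX hX0 hYi hY1 hd hcov
  have hC0 : 0 ≤ C := (abs_nonneg _).trans (hC 1 le_rfl)
  have hz : ∀ m n : ℕ, m ≤ n → (X m : ℝ) + δ * m ≤ X n + δ * n := by
    intro m n h
    have : (X m : ℝ) ≤ X n := by exact_mod_cast hX.monotone h
    have h' : (m : ℝ) ≤ n := by exact_mod_cast h
    nlinarith
  have hz' : ∀ m n : ℕ, m ≤ n → (1 + δ) * ((n : ℝ) - m) ≤ X n + δ * n - (X m + δ * m) := by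
    intro m n h
    have : (X m : ℝ) + (n - m) ≤ X n := by
      obtain ⟨k, rfl⟩ := Nat.exists_eq_add_of_le h
      have := hX.add_le_nat k m
      rw [add_comm k, add_comm k] at this
      push_cast
      have : (X m : ℝ) + k ≤ X (m + k) := by exact_mod_cast this
      linarith
    nlinarith
  have hU : ∀ t : ℕ, (X (b t) : ℝ) + δ * b t ≤ t + C := by
    intro t
    rcases Nat.eq_zero_or_pos (b t) with h | h
    · rw [h, hX0]; push_cast; have : (0 : ℝ) ≤ t := t.cast_nonneg
      linarith
    · obtain ⟨m, hm, hY⟩ := hup t h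
      have := hz _ _ hm
      have hh := (abs_le.1 (hC m (le_trans h hm))).1
      have : (Y m : ℝ) ≤ t := by exact_mod_cast hY
      linarith
  have hL : ∀ t : ℕ, (t : ℝ) - C ≤ X (b t + 1) + δ * (b t + 1 : ℕ) := by
    intro t
    obtain ⟨m, hm1, hm, hY⟩ := hlo t
    have := hz _ _ hm
    have hh := (abs_le.1 (hC m hm1)).2
    have : (t : ℝ) ≤ Y m := by exact_mod_cast hY.le
    linarith
  obtain ⟨G, hG⟩ : ∃ G : ℝ, ∀ n, (X (n + 1) : ℝ) - X n ≤ G := by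
    refine ⟨(2 * C + 2 + 2 * δ) / δ, fun n => ?_⟩
    rw [le_div_iff₀ hδ]
    have e1 : (b (X n) : ℝ) + n = X n := by exact_mod_cast hb n
    have e2 : (b (X (n + 1)) : ℝ) + (n + 1) = X (n + 1) := by exact_mod_cast hb (n + 1)
    by_cases hle : b (X n) + 1 ≤ b (X (n + 1))
    · have a1 := hz' _ _ hle
      have a2 := hU (X (n + 1))
      have a3 := hL (X n)
      push_cast at a1 a2 a3
      have e3 : (b (X (n + 1)) : ℝ) - (b (X n) + 1) = X (n + 1) - X n - 2 := by linarith
      rw [e3] at a1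
      nlinarith
    · have : (b (X (n + 1)) : ℝ) ≤ b (X n) := by exact_mod_cast (by omega)
      have : (X (n + 1) : ℝ) - X n ≤ 1 := by linarith
      nlinarith
  have hG0 : 0 ≤ G := by
    have : (X 0 : ℝ) ≤ X (0 + 1) := by exact_mod_cast (hX (Nat.lt_succ_self 0)).le
    linarith [hG 0]
  set K := C + G + δ with hK
  refine ⟨max (C / δ) (K / (α + δ - 2)), fun n => ?_⟩
  set M := max (C / δ) (K / (α + δ - 2)) with hM
  have hM1 : C / δ ≤ M := le_max_left _ _
  have hM2 : K ≤ M * (α + δ - 2) := by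
    rw [← div_le_iff₀ (by linarith)]; exact le_max_right _ _
  induction n using Nat.strong_induction_on with
  | _ n ih =>
    have e1 : (b (X n) : ℝ) + n = X n := by exact_mod_cast hb n
    have u := hU (X n)
    have l := hL (X n)
    have g := hG (b (X n))
    set N := b (X n)
    push_cast at l
    rcases lt_or_ge N n with hlt | hge
    · have hi := abs_le.1 (ih N hlt)
      have key : (X N : ℝ) + δ * N - X n
          = (X N - α * N) + (α + δ - 1) * (X n - α * n) := by
        have : (N : ℝ) = X n - n := by linarith
        rw [this]
        linear_combination (n : ℝ) * h4
      have k1 : (X N - α * N) + (α + δ - 1) * (X n - α * n) ≤ K := by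
        rw [← key]; linarith
      have k2 : -K ≤ (X N - α * N) + (α + δ - 1) * (X n - α * n) := by
        rw [← key]; linarith
      have hq : 0 < α + δ - 1 := by linarith
      rw [abs_le]
      constructor
      · refine le_of_mul_le_mul_left ?_ hq
        linarith
      · refine le_of_mul_le_mul_left ?_ hq
        linarith
    · have a : (X n : ℝ) ≤ X N := by exact_mod_cast hX.monotone hge
      have a2 : (N : ℝ) ≤ C / δ := by
        rw [le_div_iff₀ hδ]; linarith
      have a3 : (n : ℝ) ≤ N := by exact_mod_cast hge
      have a4 : (0 : ℝ) ≤ n := n.cast_nonneg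
      rw [abs_le]
      constructor <;> nlinarith


/-- Two sequences of positive integers (indexed by `ℕ+`) are complementary if
each is injective, their ranges are disjoint, and together their ranges cover
all positive integers. -/
def Complementary (x y : ℕ+ → ℕ+) : Prop :=
  Function.Injective x ∧ Function.Injective y ∧
  (∀ m n : ℕ+, x m ≠ y n) ∧
  (∀ k : ℕ+, (∃ n, x n = k) ∨ (∃ n, y n = k))

theorem central_lemma (x y : ℕ+ → ℕ+) (hcomp : Complementary x y)
    (hmono : StrictMono x) (δ C : ℝ) (hδ : 0 < δ)
    (hC : ∀ n : ℕ+, |((y n : ℕ) : ℝ) - ((x n : ℕ) : ℝ) - δ * ((n : ℕ) : ℝ)| ≤ C) :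
    ∃ α β C' : ℝ, 1 < α ∧ α < 2 ∧ 2 < β ∧
      ∀ n : ℕ+, |((x n : ℕ) : ℝ) - α * ((n : ℕ) : ℝ)| ≤ C' ∧
        |((y n : ℕ) : ℝ) - β * ((n : ℕ) : ℝ)| ≤ C' := by

  obtain ⟨hxi, hyi, hdis, hcov⟩ := hcomp
  obtain ⟨α, h1, h2, h3, h4⟩ := aux_alpha δ hδ
  let X : ℕ → ℕ := fun n => if n = 0 then 0 else (x n.toPNat' : ℕ)
  let Y : ℕ → ℕ := fun n => (y n.toPNat' : ℕ)
  have hXp : ∀ n : ℕ+, X n = x n := by intro n; simp [X]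
  have hYp : ∀ n : ℕ+, Y n = y n := by intro n; simp [Y]
  have hl : ∀ n : ℕ, 1 ≤ n → ∃ m : ℕ+, (m : ℕ) = n := fun n h => ⟨⟨n, h⟩, rfl⟩
  obtain ⟨M, hM⟩ := aux_main X Y
    (by
      intro a c hac
      obtain ⟨c, rfl⟩ := hl c (by omega)
      rw [hXp]
      rcases Nat.eq_zero_or_pos a with rfl | ha
      · simp [X]
      · obtain ⟨a, rfl⟩ := hl a ha
        rw [hXp]
        exact_mod_cast hmono (by exact_mod_cast hac))
    (by simp [X])
    (by
      intro m n hm hn h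
      obtain ⟨m, rfl⟩ := hl m hm
      obtain ⟨n, rfl⟩ := hl n hn
      rw [hYp, hYp] at h
      exact congrArg _ (hyi (PNat.coe_injective h)))
    (by intro m _; exact (y _).2)
    (by
      intro m n hm hn h
      obtain ⟨m, rfl⟩ := hl m hm
      obtain ⟨n, rfl⟩ := hl n hn
      rw [hXp, hYp] at h
      exact hdis m n (PNat.coe_injective h))
    (by
      intro k hk
      obtain ⟨k, rfl⟩ := hl k hk
      rcases hcov k with ⟨n, rfl⟩ | ⟨n, rfl⟩
      · exact Or.inl ⟨n, n.2, hXp n⟩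
      · exact Or.inr ⟨n, n.2, hYp n⟩)
    δ C hδ
    (by
      intro n hn
      obtain ⟨n, rfl⟩ := hl n hn
      rw [hXp, hYp]
      exact hC n)
    α h1 h2 h3 h4
  have hC0 : 0 ≤ C := (abs_nonneg _).trans (hC 1)
  refine ⟨α, α + δ, M + C, h1, h2, h3, fun n => ?_⟩
  have a := hM n
  rw [hXp] at a
  refine ⟨by linarith, ?_⟩
  have a := abs_le.1 a
  have c := abs_le.1 (hC n)
  rw [abs_le]
  constructor <;> linarith
end

section
/- (Fraenkel–Peled.) Let x, y be complementary, strictly increasing sequences of positive integers (indexed by n ≥ 1), and suppose there are a real δ > 0 and a constant C such that |y_n − x_n − δ·n| ≤ C for all n. Then there exist real constants α, β with 1 < α < 2 < β and a constant C′ such that |x_n − α·n| ≤ C′ and |y_n − β·n| ≤ C′ for all n. -/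
theorem fp_low (x y : ℕ+ → ℕ+) (hcomp : Complementary x y)
    (hx : StrictMono x) (hy : StrictMono y) (n j : ℕ+) (h : y j < x n) :
    (n : ℕ) + j ≤ x n := by
  have hd : Disjoint ((Finset.Icc 1 n).image x) ((Finset.Icc 1 j).image y) := by
    rw [Finset.disjoint_left]
    intro a ha hb
    simp only [Finset.mem_image] at ha hb
    obtain ⟨p, _, rfl⟩ := ha
    obtain ⟨q, _, hq⟩ := hb
    exact hcomp.2.2.1 p q hq.symm
  have hs : ((Finset.Icc 1 n).image x) ∪ ((Finset.Icc 1 j).image y) ⊆ Finset.Icc 1 (x n) := by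
    intro a ha
    simp only [Finset.mem_union, Finset.mem_image, Finset.mem_Icc] at ha ⊢
    refine ⟨PNat.one_le a, ?_⟩
    rcases ha with ⟨p, hp, rfl⟩ | ⟨p, hp, rfl⟩
    · exact hx.monotone hp.2
    · exact (hy.monotone hp.2).trans h.le
  have := Finset.card_le_card hs
  rw [Finset.card_union_of_disjoint hd, Finset.card_image_of_injective _ hcomp.1,
    Finset.card_image_of_injective _ hcomp.2.1] at this
  simpa using this

theorem fp_high (x y : ℕ+ → ℕ+) (hcomp : Complementary x y)
    (hx : StrictMono x) (hy : StrictMono y) (n j : ℕ+) (h : x n < y j) :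
    (x n : ℕ) < n + j := by
  have hs : Finset.Icc 1 (x n) ⊆
      ((Finset.Icc 1 n).image x) ∪ (((Finset.Icc 1 j).erase j).image y) := by
    intro a ha
    simp only [Finset.mem_union, Finset.mem_image, Finset.mem_Icc, Finset.mem_erase] at ha ⊢
    rcases hcomp.2.2.2 a with ⟨p, rfl⟩ | ⟨p, rfl⟩
    · exact Or.inl ⟨p, ⟨PNat.one_le p, hx.le_iff_le.1 ha.2⟩, rfl⟩
    · have := hy.lt_iff_lt.1 (ha.2.trans_lt h)
      exact Or.inr ⟨p, ⟨this.ne, PNat.one_le p, this.le⟩, rfl⟩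
  have := (Finset.card_le_card hs).trans (Finset.card_union_le _ _)
  rw [Finset.card_image_of_injective _ hcomp.1,
    Finset.card_image_of_injective _ hcomp.2.1, Finset.card_erase_of_mem (by simp)] at this
  simp at this
  have := j.pos
  omega

theorem fraenkel_peled (x y : ℕ+ → ℕ+) (hcomp : Complementary x y)
    (hxmono : StrictMono x) (hymono : StrictMono y) (δ C : ℝ) (hδ : 0 < δ)
    (hC : ∀ n : ℕ+, |((y n : ℕ) : ℝ) - ((x n : ℕ) : ℝ) - δ * ((n : ℕ) : ℝ)| ≤ C) :
    ∃ α β C' : ℝ, 1 < α ∧ α < 2 ∧ 2 < β ∧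
      ∀ n : ℕ+, |((x n : ℕ) : ℝ) - α * ((n : ℕ) : ℝ)| ≤ C' ∧
        |((y n : ℕ) : ℝ) - β * ((n : ℕ) : ℝ)| ≤ C' := by
  have hC0 : 0 ≤ C := (abs_nonneg _).trans (hC 1)
  obtain ⟨α, h1, h2, hq, hb⟩ : ∃ α : ℝ, 1 < α ∧ α < 2 ∧ α * (α + δ) = α + (α + δ) ∧ 2 < α + δ := by
    have hs : Real.sqrt (δ^2+4) ^ 2 = δ^2+4 := Real.sq_sqrt (by positivity)
    have hs0 := Real.sqrt_nonneg (δ^2+4)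
    set s := Real.sqrt (δ^2+4)
    refine ⟨(2 - δ + s)/2, ?_, ?_, ?_, ?_⟩ <;> nlinarith
  obtain ⟨β, hβ⟩ : ∃ β, β = α + δ := ⟨_, rfl⟩
  rw [← hβ] at hq hb
  obtain ⟨N, hN⟩ := exists_nat_gt (C / δ)
  have hN' : C < N * δ := by rwa [div_lt_iff₀ hδ] at hN
  obtain ⟨M, hM1, hM2⟩ : ∃ M : ℝ, (C + β) / (β - 2) ≤ M ∧
      ((x (N.succPNat) : ℕ) : ℝ) + α * (N + 1) ≤ M := ⟨_, le_max_left _ _, le_max_right _ _⟩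
  rw [div_le_iff₀ (by linarith)] at hM1
  have key : ∀ n : ℕ+, |((x n : ℕ) : ℝ) - α * ((n : ℕ) : ℝ)| ≤ M := by
    intro n
    induction n using PNat.strongInductionOn with
    | _ n ih =>
    by_cases hn : n ≤ N.succPNat
    · have e1 : ((x n : ℕ) : ℝ) ≤ (x (N.succPNat) : ℕ) := by
        exact_mod_cast hxmono.monotone hn
      have e2 : ((n : ℕ) : ℝ) ≤ N + 1 := by
        have : (n : ℕ) ≤ N + 1 := by exact_mod_cast hn
        exact_mod_cast this
      have e3 : (0:ℝ) ≤ ((x n : ℕ) : ℝ) := by positivity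
      have e4 : (0:ℝ) ≤ ((n : ℕ) : ℝ) := by positivity
      rw [abs_le]
      constructor <;> nlinarith
    · have hn1 : N + 1 < (n : ℕ) := by
        have := not_le.1 hn
        exact_mod_cast this
      have hnR : (N : ℝ) + 1 < (n : ℕ) := by exact_mod_cast hn1
      have hyx : x n < y n := by
        have := (abs_le.1 (hC n)).1
        have h3 : ((x n : ℕ) : ℝ) < (y n : ℕ) := by nlinarith
        exact_mod_cast h3
      have hxn : (n : ℕ) ≤ x n := by exact_mod_cast hxmono.le_apply
      obtain ⟨k, hk⟩ := Nat.exists_eq_add_of_le hxn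
      have hkn : k < n := by
        have := fp_high x y hcomp hxmono hymono n n hyx
        omega
      have hkR : ((x n : ℕ) : ℝ) = (n : ℕ) + k := by exact_mod_cast hk
      have up : x n < y k.succPNat := by
        rcases lt_trichotomy (x n) (y k.succPNat) with h | h | h
        · exact h
        · exact absurd h (hcomp.2.2.1 _ _)
        · have := fp_low x y hcomp hxmono hymono n _ h
          simp at this
          omega
      have upR : ((x n : ℕ) : ℝ) ≤ (y k.succPNat : ℕ) := by exact_mod_cast up.le
      have c1 := (abs_le.1 (hC k.succPNat)).2
      have hks : (((k.succPNat : ℕ+) : ℕ) : ℝ) = k + 1 := by simp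
      rw [hks] at c1
      have hαn : (α - 1) * (n : ℕ) * β = α * (n : ℕ) := by
        linear_combination ((n : ℕ) : ℝ) * hq
      have hM0 : 0 ≤ M := by
        by_contra hneg
        nlinarith
      rw [abs_le]
      constructor
      · by_cases hkk : k + 1 = n
        · have hkk' : k.succPNat = n := PNat.eq (by simpa using hkk)
          rw [hkk'] at c1 upR
          have : (k : ℝ) + 1 = (n : ℕ) := by exact_mod_cast hkk
          have hM3 : C + β ≤ M * β := by nlinarith
          by_contra hneg
          push Not at hneg
          nlinarith
        · have hlt : k.succPNat < n := by
            rw [← PNat.coe_lt_coe]; simp; omega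
          have c2 := (abs_le.1 (ih _ hlt)).2
          rw [hks] at c2
          by_contra hneg
          push Not at hneg
          nlinarith
      · rcases Nat.eq_zero_or_pos k with h0 | h0
        · subst h0
          have e4 : (0:ℝ) ≤ ((n : ℕ) : ℝ) := by positivity
          push_cast at hkR
          nlinarith
        · obtain ⟨j, hj⟩ : ∃ j : ℕ+, (j : ℕ) = k := ⟨⟨k, h0⟩, rfl⟩
          have lo : y j < x n := by
            rcases lt_trichotomy (x n) (y j) with h | h | h
            · have := fp_high x y hcomp hxmono hymono n _ h
              omega
            · exact absurd h (hcomp.2.2.1 _ _)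
            · exact h
          have loR : ((y j : ℕ) : ℝ) ≤ (x n : ℕ) := by exact_mod_cast lo.le
          have hlt : j < n := by
            rw [← PNat.coe_lt_coe]; omega
          have c2 := (abs_le.1 (ih _ hlt)).1
          have c3 := (abs_le.1 (hC j)).1
          rw [hj] at c2 c3
          by_contra hneg
          push Not at hneg
          nlinarith
  refine ⟨α, β, M + C, h1, h2, hb, fun n => ⟨(key n).trans (by linarith), ?_⟩⟩
  have a := abs_le.1 (key n)
  have b := abs_le.1 (hC n)
  rw [hβ, abs_le]
  constructor <;> linarith [a.1, a.2, b.1, b.2]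
end

section
/- Let x, y be complementary sequences of positive integers (indexed by n ≥ 1) with x strictly increasing, and suppose there are a real δ > 0 and a constant C such that |y_n − x_n − δ·n| ≤ C for all n. Then the sequences have bounded jumps: there is a constant K such that for all n, x_{n+1} − x_n ≤ K and |y_{n+1} − y_n| ≤ K. -/
theorem x_growth (x : ℕ+ → ℕ+) (hmono : StrictMono x) (m : ℕ+) (d : ℕ) (m' : ℕ+)
    (h : (m' : ℕ) = m + d) : (x m : ℕ) + d ≤ x m' := by
  induction d generalizing m' with
  | zero =>
    have : m' = m := PNat.eq (by simpa using h)
    subst this; simp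
  | succ d ih =>
    have h1 := ih ⟨m + d, by have := m.pos; omega⟩ rfl
    have h2 : x ⟨m + d, by have := m.pos; omega⟩ < x m' := by
      apply hmono
      change (m : ℕ) + d < (m' : ℕ)
      omega
    rw [← PNat.coe_lt_coe] at h2
    omega

theorem gap_bound (x y : ℕ+ → ℕ+) (hcomp : Complementary x y)
    (hmono : StrictMono x) (δ C : ℝ) (hδ : 0 < δ)
    (hC : ∀ n : ℕ+, |((y n : ℕ) : ℝ) - ((x n : ℕ) : ℝ) - δ * ((n : ℕ) : ℝ)| ≤ C) (n : ℕ+) :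
    ((x (n + 1) : ℕ) : ℝ) - ((x n : ℕ) : ℝ) ≤ 2 * C / δ + 2 := by
  obtain ⟨-, -, -, hcov⟩ := hcomp
  have hC0 : 0 ≤ C := (abs_nonneg _).trans (hC 1)
  have hq : 0 ≤ 2 * C / δ := by positivity
  have hS : ∀ k : ℕ+, ∃ m, k ∈ Finset.Ioo (x n) (x (n + 1)) → y m = k := by
    intro k
    rcases hcov k with ⟨m, hm⟩ | ⟨m, hm⟩
    · refine ⟨1, fun hk => ?_⟩
      rw [Finset.mem_Ioo, ← hm, hmono.lt_iff_lt, hmono.lt_iff_lt, PNat.lt_add_one_iff] at hk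
      exact absurd hk.1 (not_lt.2 hk.2)
    · exact ⟨m, fun _ => hm⟩
  choose g hg using hS
  have hcard : ((Finset.Ioo (x n) (x (n + 1))).image g).card = (x (n + 1) : ℕ) - x n - 1 := by
    rw [Finset.card_image_of_injOn, PNat.card_Ioo]
    intro a ha b hb hab
    rw [← hg a ha, ← hg b hb, hab]
  rcases ((Finset.Ioo (x n) (x (n + 1))).image g).eq_empty_or_nonempty with he | hne
  · rw [he, Finset.card_empty] at hcard
    have : (x (n + 1) : ℕ) ≤ x n + 1 := by omega
    have : ((x (n + 1) : ℕ) : ℝ) ≤ (x n : ℕ) + 1 := by exact_mod_cast this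
    linarith
  · set M := (Finset.Ioo (x n) (x (n + 1))).image g with hM
    have hsub : M ⊆ Finset.Icc (M.min' hne) (M.max' hne) := fun m hm =>
      Finset.mem_Icc.2 ⟨M.min'_le m hm, M.le_max' m hm⟩
    have hle := Finset.card_le_card hsub
    rw [PNat.card_Icc, hcard] at hle
    have hmem : ∀ m ∈ M, (x n : ℕ) < y m ∧ (y m : ℕ) < x (n + 1) := by
      intro m hm
      obtain ⟨k, hk, rfl⟩ := Finset.mem_image.1 hm
      rw [hg k hk]
      simpa using hk
    have h0 := hmem _ (M.min'_mem hne)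
    have h1 := hmem _ (M.max'_mem hne)
    have h01 : M.min' hne ≤ M.max' hne := M.min'_le _ (M.max'_mem hne)
    generalize M.min' hne = p at *
    generalize M.max' hne = q at *
    have hpq : (p : ℕ) ≤ q := h01
    have hx := x_growth x hmono p (q - p) q (by omega)
    have hp := abs_le.1 (hC p)
    have hq' := abs_le.1 (hC q)
    have e1 : ((x (n+1) : ℕ) : ℝ) ≤ (x n : ℕ) + 2 + ((q : ℕ) : ℝ) - ((p : ℕ) : ℝ) := by
      have : (x (n+1) : ℕ) + (p : ℕ) ≤ (x n : ℕ) + 2 + q := by omega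
      have : ((x (n+1) : ℕ) : ℝ) + ((p : ℕ) : ℝ) ≤ (x n : ℕ) + 2 + ((q : ℕ) : ℝ) := by
        exact_mod_cast this
      linarith
    have e2 : ((x p : ℕ) : ℝ) + (q : ℕ) ≤ (x q : ℕ) + (p : ℕ) := by
      have : (x p : ℕ) + (q : ℕ) ≤ x q + p := by omega
      exact_mod_cast this
    have e3 : ((y q : ℕ) : ℝ) + (x n : ℕ) + 2 ≤ (x (n+1) : ℕ) + (y p : ℕ) := by
      have : (y q : ℕ) + x n + 2 ≤ x (n+1) + y p := by omega
      exact_mod_cast this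
    have e4 : δ * (((q : ℕ) : ℝ) - (p : ℕ)) ≤ 2 * C := by linarith
    have e5 : ((q : ℕ) : ℝ) - (p : ℕ) ≤ 2 * C / δ := by
      rw [le_div_iff₀ hδ]; linarith
    linarith

theorem bounded_jumps (x y : ℕ+ → ℕ+) (hcomp : Complementary x y)
    (hmono : StrictMono x) (δ C : ℝ) (hδ : 0 < δ)
    (hC : ∀ n : ℕ+, |((y n : ℕ) : ℝ) - ((x n : ℕ) : ℝ) - δ * ((n : ℕ) : ℝ)| ≤ C) :
    ∃ K : ℤ, ∀ n : ℕ+, ((x (n + 1) : ℕ) : ℤ) - ((x n : ℕ) : ℤ) ≤ K ∧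
      |((y (n + 1) : ℕ) : ℤ) - ((y n : ℕ) : ℤ)| ≤ K := by
  have hC0 : 0 ≤ C := (abs_nonneg _).trans (hC 1)
  refine ⟨⌈2 * C / δ + 2 + δ + 2 * C⌉, fun n => ?_⟩
  have hK := Int.le_ceil (2 * C / δ + 2 + δ + 2 * C)
  have hg := gap_bound x y hcomp hmono δ C hδ hC n
  have hx : ((x n : ℕ) : ℝ) ≤ (x (n + 1) : ℕ) := by
    exact_mod_cast (hmono (PNat.lt_add_right n 1)).le
  have ha := abs_le.1 (hC n)
  have hb := abs_le.1 (hC (n + 1))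
  rw [PNat.add_coe, PNat.one_coe] at hb
  push_cast at hb
  generalize ⌈2 * C / δ + 2 + δ + 2 * C⌉ = K at *
  constructor
  · have : ((x (n + 1) : ℕ) : ℝ) - ((x n : ℕ) : ℝ) ≤ (K : ℝ) := by linarith
    exact_mod_cast this
  · have : |((y (n + 1) : ℕ) : ℝ) - ((y n : ℕ) : ℝ)| ≤ (K : ℝ) := by
      rw [abs_le]; constructor <;> linarith
    exact_mod_cast this
end

section
/- Let x, y be complementary sequences of positive integers (indexed by n ≥ 1) with x strictly increasing, let α, β be positive reals, and suppose there is a constant C such that |x_n − α·n| ≤ C and |y_n − β·n| ≤ C for all n. Then 1/α + 1/β = 1. -/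
open Classical in
theorem count_aux (g : ℕ → ℕ) (hg : Function.Injective g) (hpos : ∀ k, 1 ≤ g k) (a C : ℝ)
    (ha : 0 < a) (hC : ∀ k : ℕ, |(g k : ℝ) - a * ((k : ℝ) + 1)| ≤ C) (N : ℕ) :
    ((N : ℝ) - C) / a - 1 ≤ (((Finset.Icc 1 N).filter (fun m => ∃ k, g k = m)).card : ℝ) ∧
    (((Finset.Icc 1 N).filter (fun m => ∃ k, g k = m)).card : ℝ) ≤ ((N : ℝ) + C) / a := by
  have hC0 : 0 ≤ C := le_trans (abs_nonneg _) (hC 0)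
  constructor
  · have hsub : (Finset.range ⌊((N : ℝ) - C) / a⌋₊).image g ⊆
        (Finset.Icc 1 N).filter (fun m => ∃ k, g k = m) := by
      intro m hm
      obtain ⟨k, hk, rfl⟩ := Finset.mem_image.1 hm
      have hk := Finset.mem_range.1 hk
      have h1 : ((k + 1 : ℕ) : ℝ) ≤ ((N : ℝ) - C) / a :=
        (Nat.le_floor_iff' (Nat.succ_ne_zero k)).1 hk
      rw [le_div_iff₀ ha] at h1
      push_cast at h1
      have h2 := (abs_le.1 (hC k)).2
      have h3 : (g k : ℝ) ≤ N := by nlinarith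
      simp only [Finset.mem_filter, Finset.mem_Icc]
      exact ⟨⟨hpos k, by exact_mod_cast h3⟩, k, rfl⟩
    have h := Finset.card_le_card hsub
    rw [Finset.card_image_of_injective _ hg, Finset.card_range] at h
    have h' : ((⌊((N : ℝ) - C) / a⌋₊ : ℕ) : ℝ) ≤ _ := Nat.cast_le.2 h
    have := Nat.lt_floor_add_one (((N : ℝ) - C) / a)
    linarith
  · have hsub : (Finset.Icc 1 N).filter (fun m => ∃ k, g k = m) ⊆
        (Finset.range ⌊((N : ℝ) + C) / a⌋₊).image g := by
      intro m hm
      simp only [Finset.mem_filter, Finset.mem_Icc] at hm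
      obtain ⟨⟨_, hN⟩, k, rfl⟩ := hm
      refine Finset.mem_image.2 ⟨k, Finset.mem_range.2 ?_, rfl⟩
      have hN' : (g k : ℝ) ≤ N := by exact_mod_cast hN
      have h2 := (abs_le.1 (hC k)).1
      refine Nat.succ_le_iff.1 ((Nat.le_floor_iff' (Nat.succ_ne_zero k)).2 ?_)
      rw [le_div_iff₀ ha]
      push_cast
      nlinarith
    have h := (Finset.card_le_card hsub).trans Finset.card_image_le
    rw [Finset.card_range] at h
    exact (Nat.cast_le.2 h).trans (Nat.floor_le (by positivity))

theorem densities_beatty (x y : ℕ+ → ℕ+) (hcomp : Complementary x y)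
    (hmono : StrictMono x) (α β : ℝ) (hα : 0 < α) (hβ : 0 < β) (C : ℝ)
    (hC : ∀ n : ℕ+, |((x n : ℕ) : ℝ) - α * ((n : ℕ) : ℝ)| ≤ C ∧
      |((y n : ℕ) : ℝ) - β * ((n : ℕ) : ℝ)| ≤ C) :
    1 / α + 1 / β = 1 := by
  classical
  obtain ⟨hx, hy, hd, hc⟩ := hcomp
  have hs : Function.Injective Nat.succPNat := Nat.succPNat_injective
  have X := count_aux (fun k => (x k.succPNat : ℕ)) (PNat.coe_injective.comp (hx.comp hs))
    (fun k => (x _).pos) α C hα (fun k => by simpa using (hC k.succPNat).1)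
  have Y := count_aux (fun k => (y k.succPNat : ℕ)) (PNat.coe_injective.comp (hy.comp hs))
    (fun k => (y _).pos) β C hβ (fun k => by simpa using (hC k.succPNat).2)
  have key : ∀ N : ℕ,
      (((Finset.Icc 1 N).filter (fun m => ∃ k : ℕ, (x k.succPNat : ℕ) = m)).card : ℝ) +
      (((Finset.Icc 1 N).filter (fun m => ∃ k : ℕ, (y k.succPNat : ℕ) = m)).card : ℝ) = N := by
    intro N
    rw [← Nat.cast_add, ← Finset.card_union_of_disjoint]
    · rw [← Finset.filter_or, Finset.filter_true_of_mem]
      · simp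
      · intro m hm
        have hm := (Finset.mem_Icc.1 hm).1
        rcases hc ⟨m, hm⟩ with ⟨n, hn⟩ | ⟨n, hn⟩
        · exact Or.inl ⟨n.natPred, by rw [PNat.succPNat_natPred, hn]; rfl⟩
        · exact Or.inr ⟨n.natPred, by rw [PNat.succPNat_natPred, hn]; rfl⟩
    · rw [Finset.disjoint_filter]
      rintro m _ ⟨k, hk⟩ ⟨l, hl⟩
      exact hd _ _ (PNat.coe_injective (hk.trans hl.symm))
  have low : ∀ N : ℕ, (N : ℝ) * (1 / α + 1 / β - 1) ≤ C / α + C / β + 2 := by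
    intro N
    have h1 := (X N).1
    have h2 := (Y N).1
    have h3 := key N
    have e1 : (N : ℝ) * (1 / α + 1 / β - 1) =
      ((N : ℝ) - C) / α + ((N : ℝ) - C) / β - N + (C / α + C / β) := by ring
    linarith
  have up : ∀ N : ℕ, (N : ℝ) * (1 - (1 / α + 1 / β)) ≤ C / α + C / β + 2 := by
    intro N
    have h1 := (X N).2
    have h2 := (Y N).2
    have h3 := key N
    have e1 : (N : ℝ) * (1 - (1 / α + 1 / β)) =
      N - ((N : ℝ) + C) / α - ((N : ℝ) + C) / β + (C / α + C / β) := by ring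
    linarith
  have arch : ∀ d K : ℝ, (∀ N : ℕ, (N : ℝ) * d ≤ K) → d ≤ 0 := by
    intro d K h
    by_contra! hd
    obtain ⟨n, hn⟩ := exists_nat_gt (K / d)
    rw [div_lt_iff₀ hd] at hn
    linarith [h n]
  linarith [arch _ _ low, arch _ _ up]
end

section
/- Let x, y be complementary sequences of positive integers (indexed by n ≥ 1) with x strictly increasing, let δ > 0 and α > 0 be reals, and suppose there is a constant C such that |y_n − x_n − δ·n| ≤ C and |x_n − α·n| ≤ C for all n. Then δ·(1 − α) + α = (α − 1)·α, i.e., α² + (δ − 2)·α − δ = 0. -/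
open Classical in
lemma count_bound (g : ℕ → ℕ) (hg : Function.Injective g) (a D : ℝ) (ha : 0 < a)
    (h : ∀ n : ℕ, |(g n : ℝ) - a * n| ≤ D) :
    ∃ K : ℝ, ∀ N : ℕ,
      |(((Finset.range N).filter (fun k => ∃ n, g n = k)).card : ℝ) - N / a| ≤ K := by
  have hD : 0 ≤ D := (abs_nonneg _).trans (h 0)
  refine ⟨D / a + 1, fun N => ?_⟩
  have hN : (0 : ℝ) ≤ N := Nat.cast_nonneg N
  rw [abs_le]
  constructor
  · have hsub : (Finset.range ⌊((N : ℝ) - D) / a⌋₊).image g ⊆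
        (Finset.range N).filter (fun k => ∃ n, g n = k) := by
      intro k hk
      obtain ⟨n, hn, rfl⟩ := Finset.mem_image.1 hk
      refine Finset.mem_filter.2 ⟨Finset.mem_range.2 ?_, n, rfl⟩
      have h1 := Nat.lt_of_lt_floor (Finset.mem_range.1 hn)
      rw [lt_div_iff₀ ha] at h1
      have h2 := (abs_le.1 (h n)).2
      have : (g n : ℝ) < N := by linarith
      exact_mod_cast this
    have hc := Finset.card_le_card hsub
    rw [Finset.card_image_of_injective _ hg, Finset.card_range] at hc
    have hc' : ((⌊((N : ℝ) - D) / a⌋₊ : ℕ) : ℝ) ≤ _ := Nat.cast_le.2 hc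
    have := Nat.lt_floor_add_one (((N : ℝ) - D) / a)
    rw [sub_div] at this hc'
    linarith
  · have hsub : (Finset.range N).filter (fun k => ∃ n, g n = k) ⊆
        (Finset.range (⌊((N : ℝ) + D) / a⌋₊ + 1)).image g := by
      intro k hk
      obtain ⟨hk, n, rfl⟩ := Finset.mem_filter.1 hk
      refine Finset.mem_image.2 ⟨n, Finset.mem_range.2 (Nat.lt_succ_of_le (Nat.le_floor ?_)), rfl⟩
      have h1 : (g n : ℝ) < N := by exact_mod_cast Finset.mem_range.1 hk
      rw [le_div_iff₀ ha]
      have h2 := (abs_le.1 (h n)).1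
      linarith
    have hc := Finset.card_le_card hsub
    rw [Finset.card_image_of_injective _ hg, Finset.card_range] at hc
    have hc' : _ ≤ ((⌊((N : ℝ) + D) / a⌋₊ + 1 : ℕ) : ℝ) := Nat.cast_le.2 hc
    have := Nat.floor_le (show 0 ≤ ((N : ℝ) + D) / a by positivity)
    push_cast at hc'
    rw [add_div] at this hc'
    linarith

lemma shift_bound (f : ℕ+ → ℕ+) (a C : ℝ)
    (h : ∀ n : ℕ+, |((f n : ℕ) : ℝ) - a * ((n : ℕ) : ℝ)| ≤ C) (n : ℕ) :
    |(((f n.succPNat).natPred : ℕ) : ℝ) - a * n| ≤ C + |a| + 1 := by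
  have h1 := h n.succPNat
  have h2 : (((f n.succPNat : ℕ+) : ℕ) : ℝ) = ((f n.succPNat).natPred : ℕ) + 1 := by
    exact_mod_cast (PNat.natPred_add_one (f n.succPNat)).symm
  rw [h2] at h1
  simp only [Nat.succPNat_coe, Nat.succ_eq_add_one, Nat.cast_add, Nat.cast_one] at h1
  rw [abs_le] at h1 ⊢
  have := neg_abs_le a
  have := le_abs_self a
  constructor <;> linarith [h1.1, h1.2]

theorem delta_alpha_relation (x y : ℕ+ → ℕ+) (hcomp : Complementary x y)
    (hmono : StrictMono x) (δ α : ℝ) (hδ : 0 < δ) (hα : 0 < α) (C : ℝ)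
    (hC : ∀ n : ℕ+, |((y n : ℕ) : ℝ) - ((x n : ℕ) : ℝ) - δ * ((n : ℕ) : ℝ)| ≤ C ∧
      |((x n : ℕ) : ℝ) - α * ((n : ℕ) : ℝ)| ≤ C) :
    δ * (1 - α) + α = (α - 1) * α := by
  classical
  obtain ⟨hx, hy, hd, hu⟩ := hcomp
  have hβ : 0 < α + δ := by linarith
  have hyb : ∀ n : ℕ+, |((y n : ℕ) : ℝ) - (α + δ) * ((n : ℕ) : ℝ)| ≤ 2 * C := by
    intro n
    obtain ⟨h1, h2⟩ := hC n
    rw [abs_le] at *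
    constructor <;> linarith [h1.1, h1.2, h2.1, h2.2]
  have hinj : ∀ f : ℕ+ → ℕ+, Function.Injective f →
      Function.Injective (fun n : ℕ => (f n.succPNat).natPred) := fun f hf =>
    PNat.natPred_injective.comp (hf.comp Nat.succPNat_injective)
  obtain ⟨K, hK⟩ := count_bound _ (hinj x hx) α _ hα (shift_bound x α C (fun n => (hC n).2))
  obtain ⟨L, hL⟩ := count_bound _ (hinj y hy) (α + δ) _ hβ (shift_bound y (α + δ) (2 * C) hyb)
  have hsum : ∀ N : ℕ,
      ((Finset.range N).filter (fun k => ∃ n : ℕ, (x n.succPNat).natPred = k)).card +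
      ((Finset.range N).filter (fun k => ∃ n : ℕ, (y n.succPNat).natPred = k)).card = N := by
    intro N
    rw [← Finset.card_union_of_disjoint, ← Finset.filter_or, Finset.filter_true_of_mem,
      Finset.card_range]
    · intro k _
      rcases hu k.succPNat with ⟨n, hn⟩ | ⟨n, hn⟩
      · exact Or.inl ⟨n.natPred, by simp [hn]⟩
      · exact Or.inr ⟨n.natPred, by simp [hn]⟩
    · rw [Finset.disjoint_filter]
      rintro k _ ⟨n, hn⟩ ⟨m, hm⟩
      exact hd _ _ (PNat.natPred_injective (hn.trans hm.symm))
  have key : 1 - 1 / α - 1 / (α + δ) = 0 := by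
    by_contra hne
    obtain ⟨N, hN⟩ := exists_nat_gt ((K + L) / |1 - 1 / α - 1 / (α + δ)|)
    rw [div_lt_iff₀ (abs_pos.2 hne)] at hN
    have h1 := hK N
    have h2 := hL N
    have h3 : ((_ : ℕ) : ℝ) = (N : ℝ) := congrArg (Nat.cast) (hsum N)
    push_cast at h3
    have h4 : |(N : ℝ) * (1 - 1 / α - 1 / (α + δ))| ≤ K + L := by
      have e : (N : ℝ) * (1 - 1 / α - 1 / (α + δ)) = N - N / α - N / (α + δ) := by ring
      rw [e]
      rw [abs_le] at *
      constructor <;> linarith [h1.1, h1.2, h2.1, h2.2]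
    rw [abs_mul, Nat.abs_cast] at h4
    linarith
  field_simp at key
  linarith
end

section
/- There is a constant C > 0 such that every P-position (x, y) of (2,3)-Maharaja Nim with y ≥ x satisfies |y − φ·x| ≤ C, where φ = (1 + √5)/2 is the golden ratio. -/
/-- One move of (2,3)-Maharaja Nim: from `p` to `q` by a Nim move (decrease one
coordinate), a diagonal move (decrease both by the same positive amount), or a
Knight-type move `(2,3)` or `(3,2)`. -/
def Mah23Move (p q : ℕ × ℕ) : Prop :=
  (∃ k, 0 < k ∧ q.1 + k = p.1 ∧ q.2 = p.2) ∨
  (∃ k, 0 < k ∧ q.1 = p.1 ∧ q.2 + k = p.2) ∨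
  (∃ k, 0 < k ∧ q.1 + k = p.1 ∧ q.2 + k = p.2) ∨
  (q.1 + 2 = p.1 ∧ q.2 + 3 = p.2) ∨
  (q.1 + 3 = p.1 ∧ q.2 + 2 = p.2)

theorem Mah23Move.lt {p q : ℕ × ℕ} (h : Mah23Move p q) : q.1 + q.2 < p.1 + p.2 := by
  rcases h with ⟨k, hk, h1, h2⟩ | ⟨k, hk, h1, h2⟩ | ⟨k, hk, h1, h2⟩ | ⟨h1, h2⟩ | ⟨h1, h2⟩ <;> omega

/-- The P-positions of (2,3)-Maharaja Nim: `p` is P iff every move from `p`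
leads to a non-P position. -/
def Mah23P (p : ℕ × ℕ) : Prop :=
  ∀ q, Mah23Move p q → ¬ Mah23P q
termination_by p.1 + p.2
decreasing_by exact Mah23Move.lt ‹_›

namespace Mah

abbrev Q (x y : ℕ) : Prop := Mah23P (x, y)

theorem Q_not {x y u w : ℕ} (h : Q x y) (hm : Mah23Move (x, y) (u, w)) : ¬ Q u w := by
  unfold Q at h
  rw [Mah23P] at h
  exact h _ hm

theorem Q_of {x y : ℕ} (h : ∀ u w, Mah23Move (x, y) (u, w) → ¬ Q u w) : Q x y := by
  unfold Q
  rw [Mah23P]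
  rintro ⟨u, w⟩ hm
  exact h u w hm

theorem Q_col_lt {x y y' : ℕ} (h : Q x y) (h' : Q x y') : ¬ y < y' := fun hl =>
  Q_not (u := x) (w := y) h' (Or.inr (Or.inl ⟨y' - y, by omega, rfl, by simp only; omega⟩)) h

theorem Q_col {x y y' : ℕ} (h : Q x y) (h' : Q x y') : y = y' := by
  have := Q_col_lt h h'
  have := Q_col_lt h' h
  omega

theorem Q_row_lt {x x' y : ℕ} (h : Q x y) (h' : Q x' y) : ¬ x < x' := fun hl =>
  Q_not (u := x) (w := y) h' (Or.inl ⟨x' - x, by omega, by simp only; omega, rfl⟩) h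

theorem Q_row {x x' y : ℕ} (h : Q x y) (h' : Q x' y) : x = x' := by
  have := Q_row_lt h h'
  have := Q_row_lt h' h
  omega

theorem Q_diag_lt {x x' d : ℕ} (h : Q x (x + d)) (h' : Q x' (x' + d)) : ¬ x < x' := fun hl =>
  Q_not h' (Or.inr (Or.inr (Or.inl ⟨x' - x, by omega, by simp only; omega, by simp only; omega⟩))) h

theorem Q_diag {x x' d : ℕ} (h : Q x (x + d)) (h' : Q x' (x' + d)) : x = x' := by
  have := Q_diag_lt h h'
  have := Q_diag_lt h' h
  omega

theorem move_symm {x y u w : ℕ} (h : Mah23Move (x, y) (u, w)) : Mah23Move (y, x) (w, u) := by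
  rcases h with ⟨k, hk, h1, h2⟩ | ⟨k, hk, h1, h2⟩ | ⟨k, hk, h1, h2⟩ | ⟨h1, h2⟩ | ⟨h1, h2⟩
  · exact Or.inr (Or.inl ⟨k, hk, h2, h1⟩)
  · exact Or.inl ⟨k, hk, h2, h1⟩
  · exact Or.inr (Or.inr (Or.inl ⟨k, hk, h2, h1⟩))
  · exact Or.inr (Or.inr (Or.inr (Or.inr ⟨h2, h1⟩)))
  · exact Or.inr (Or.inr (Or.inr (Or.inl ⟨h2, h1⟩)))

theorem Q_symm_aux (n : ℕ) : ∀ x y, x + y = n → Q x y → Q y x := by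
  induction n using Nat.strong_induction_on with
  | _ n ih =>
    intro x y hn h
    apply Q_of
    intro u w hm hq
    have hlt := hm.lt
    simp only at hlt
    exact Q_not h (move_symm hm) (ih (u + w) (by omega) u w rfl hq)

theorem Q_symm {x y : ℕ} (h : Q x y) : Q y x := Q_symm_aux _ x y rfl h

theorem Q00 : Q 0 0 := by
  apply Q_of
  intro u w hm
  have := hm.lt
  simp at this

def V (r : ℕ) : Prop := ∃ u, u ≤ r ∧ Q u r

open Classical in
noncomputable def c : ℕ → ℕ
  | 0 => 0
  | r + 1 => if V r then c r + 1 else 0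

open Classical in
noncomputable def v : ℕ → ℕ
  | 0 => 0
  | r + 1 => if V r then v r + 1 else v r

def Kn (X x y : ℕ) : Prop :=
  ∃ u w, u < X ∧ u ≤ w ∧ Q u w ∧ ((u + 2 = x ∧ w + 3 = y) ∨ (u + 3 = x ∧ w + 2 = y))

structure Inv_s15 (x m D R A0 A1 A2 i o e f : ℕ) : Prop where
  hx : 1 ≤ x
  hm : 1 ≤ m
  dlow : ∀ d < m, ∃ u < x, Q u (u + d)
  dD : ∀ j, D.testBit j = true ↔ ∃ u < x, Q u (u + (m + j))
  dR : ∀ j, R.testBit j = true ↔ ∃ u < x, Q u (x + m + j)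
  k0 : ∀ j, A0.testBit j = true ↔ Kn x x (x + m + j)
  k1 : ∀ j, A1.testBit j = true ↔ Kn x (x + 1) (x + m + j)
  k2 : ∀ j, A2.testBit j = true ↔ Kn x (x + 2) (x + m + j)
  c3 : ∀ r ≤ x + m, c r ≤ 3
  ci : c x = i
  co : c (x + m) = o
  ve : x + 1 = v x + m + e
  vf : x + 1 = v x + v (x + m) + f

def runo (o M : ℕ) : ℕ → ℕ
  | 0 => o
  | k + 1 => if M.testBit k then runo o M k + 1 else 0

def cnt (M : ℕ) : ℕ → ℕ
  | 0 => 0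
  | k + 1 => if M.testBit k then cnt M k + 1 else cnt M k

theorem Kn_succ {x z y0 r : ℕ} (hy0 : x ≤ y0) (hq : Q x y0) :
    Kn (x + 1) z r ↔ Kn x z r ∨ (z = x + 2 ∧ r = y0 + 3) ∨ (z = x + 3 ∧ r = y0 + 2) := by
  constructor
  · rintro ⟨u, w, hu, huw, h, hh⟩
    rcases Nat.lt_succ_iff_lt_or_eq.1 hu with hu | rfl
    · exact Or.inl ⟨u, w, hu, huw, h, hh⟩
    · have := Q_col h hq
      right
      omega
  · rintro (⟨u, w, hu, huw, h, hh⟩ | h)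
    · exact ⟨u, w, by omega, huw, h, hh⟩
    · exact ⟨x, y0, by omega, hy0, hq, by omega⟩

theorem Kn_succ' {x z r : ℕ} (hq : ∀ w, x ≤ w → ¬ Q x w) :
    Kn (x + 1) z r ↔ Kn x z r := by
  constructor
  · rintro ⟨u, w, hu, huw, h, hh⟩
    rcases Nat.lt_succ_iff_lt_or_eq.1 hu with hu | rfl
    · exact ⟨u, w, hu, huw, h, hh⟩
    · exact absurd h (hq w huw)
  · rintro ⟨u, w, hu, huw, h, hh⟩
    exact ⟨u, w, by omega, huw, h, hh⟩

theorem Kn_far {x z r : ℕ} (hz : x + 3 ≤ z) : ¬ Kn x z r := by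
  rintro ⟨u, w, hu, huw, h, hh⟩
  omega

theorem step {x m D R A0 A1 A2 i o e f : ℕ} (h : Inv_s15 x m D R A0 A1 A2 i o e f)
    (N m' e' f' i' b : ℕ)
    (hN : ∀ j, N.testBit j = true ↔ Q x (x + m + j))
    (hcases : ∀ z r, Kn (x + 1) z r ↔ Kn x z r ∨ ∃ y, N.testBit y = true ∧
      ((z = x + 2 ∧ r = x + m + y + 3) ∨ (z = x + 3 ∧ r = x + m + y + 2)))
    (hm' : ∀ j < m', (D ||| N).testBit j = true)
    (hk : ∀ k ≤ m' + 1, runo o (R ||| N) k ≤ 3)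
    (hb : (V x ∧ b = 1 ∧ i' = i + 1) ∨ (¬ V x ∧ b = 0 ∧ i' = 0))
    (he : e' + m' + b = e + 1) (hf : f' + cnt (R ||| N) (m' + 1) + b = f + 1) :
    Inv_s15 (x + 1) (m + m') ((D ||| N) >>> m') ((R ||| N) >>> (m' + 1)) (A1 >>> (m' + 1))
      ((A2 ||| (N <<< 3)) >>> (m' + 1)) ((N <<< 2) >>> (m' + 1)) i'
      (runo o (R ||| N) (m' + 1)) e' f' := by
  have hD : ∀ j, (D ||| N).testBit j = true ↔ ∃ u < x + 1, Q u (u + (m + j)) := by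
    intro j
    rw [Nat.testBit_or, Bool.or_eq_true, h.dD, hN]
    constructor
    · rintro (⟨u, hu, hq⟩ | hq)
      · exact ⟨u, by omega, hq⟩
      · exact ⟨x, by omega, by rwa [← add_assoc]⟩
    · rintro ⟨u, hu, hq⟩
      rcases Nat.lt_succ_iff_lt_or_eq.1 hu with hu | rfl
      · exact Or.inl ⟨u, hu, hq⟩
      · exact Or.inr (by rwa [← add_assoc] at hq)
  have hR : ∀ j, (R ||| N).testBit j = true ↔ ∃ u < x + 1, Q u (x + m + j) := by
    intro j
    rw [Nat.testBit_or, Bool.or_eq_true, h.dR, hN]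
    constructor
    · rintro (⟨u, hu, hq⟩ | hq)
      · exact ⟨u, by omega, hq⟩
      · exact ⟨x, by omega, hq⟩
    · rintro ⟨u, hu, hq⟩
      rcases Nat.lt_succ_iff_lt_or_eq.1 hu with hu | rfl
      · exact Or.inl ⟨u, hu, hq⟩
      · exact Or.inr hq
  have hlow : ∀ d < m + m', ∃ u < x + 1, Q u (u + d) := by
    intro d hd
    by_cases hdm : d < m
    · obtain ⟨u, hu, hq⟩ := h.dlow d hdm
      exact ⟨u, by omega, hq⟩
    · have := (hD (d - m)).1 (hm' _ (by omega))
      rwa [show m + (d - m) = d by omega] at this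
  have hV : ∀ j < m' + 1, V (x + m + j) ↔ (R ||| N).testBit j = true := by
    intro j hj
    rw [hR]
    constructor
    · rintro ⟨u, hu, hq⟩
      refine ⟨u, ?_, hq⟩
      by_contra hux
      obtain ⟨u', hu', hq'⟩ := hlow (x + m + j - u) (by omega)
      have hq2 : Q u (u + (x + m + j - u)) := by
        rwa [show u + (x + m + j - u) = x + m + j by omega]
      have := Q_diag hq' hq2
      omega
    · rintro ⟨u, hu, hq⟩
      exact ⟨u, by omega, hq⟩
  have hc : ∀ k ≤ m' + 1, c (x + m + k) = runo o (R ||| N) k := by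
    intro k
    induction k with
    | zero => intro _; exact h.co
    | succ k ih =>
      intro hk'
      have hv := hV k (by omega)
      rw [← add_assoc, c, runo, ih (by omega)]
      simp only [hv]
  have hv : ∀ k ≤ m' + 1, v (x + m + k) = v (x + m) + cnt (R ||| N) k := by
    intro k
    induction k with
    | zero => intro _; rfl
    | succ k ih =>
      intro hk'
      have hv := hV k (by omega)
      rw [← add_assoc, v, cnt, ih (by omega)]
      simp only [hv]
      split_ifs <;> omega
  have hvx : v (x + 1) = v x + b := by
    rw [v]
    rcases hb with ⟨h1, h2, -⟩ | ⟨h1, h2, -⟩ <;> simp [h1, h2]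
  have e1 : x + 1 + (m + m') = x + m + (m' + 1) := by omega
  have h1 := h.hx
  have h2 := h.hm
  refine ⟨by omega, by omega, hlow, ?_, ?_, ?_, ?_, ?_, ?_, ?_, ?_, ?_, ?_⟩
  · intro j
    rw [Nat.testBit_shiftRight, hD, add_assoc]
  · intro j
    rw [Nat.testBit_shiftRight, hR, e1, add_assoc (x + m)]
  · intro j
    rw [Nat.testBit_shiftRight, h.k1, hcases, e1, add_assoc (x + m)]
    constructor
    · exact Or.inl
    · rintro (h | ⟨y, -, h⟩)
      · exact h
      · omega
  · intro j
    rw [Nat.testBit_shiftRight, Nat.testBit_or, Bool.or_eq_true, h.k2, hcases, e1,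
      add_assoc (x + m), Nat.testBit_shiftLeft]
    refine or_congr Iff.rfl ?_
    simp only [Bool.and_eq_true, decide_eq_true_eq]
    constructor
    · rintro ⟨h1, h2⟩
      refine ⟨m' + 1 + j - 3, h2, Or.inl ⟨?_, ?_⟩⟩ <;> first | trivial | omega
    · rintro ⟨y, hy, hh⟩
      refine ⟨by omega, ?_⟩
      rwa [show m' + 1 + j - 3 = y by omega]
  · intro j
    rw [Nat.testBit_shiftRight, hcases, e1,
      add_assoc (x + m), Nat.testBit_shiftLeft]
    simp only [Bool.and_eq_true, decide_eq_true_eq]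
    constructor
    · rintro ⟨h1, h2⟩
      refine Or.inr ⟨m' + 1 + j - 2, h2, Or.inr ⟨?_, ?_⟩⟩ <;> first | trivial | omega
    · rintro (hh | ⟨y, hy, hh⟩)
      · exact absurd hh (Kn_far (by omega))
      · refine ⟨by omega, ?_⟩
        rwa [show m' + 1 + j - 2 = y by omega]
  · intro r hr
    by_cases hrm : r ≤ x + m
    · exact h.c3 r hrm
    · have := hc (r - (x + m)) (by omega)
      rw [show x + m + (r - (x + m)) = r by omega] at this
      rw [this]
      exact hk _ (by omega)
  · rw [c]
    rcases hb with ⟨h1, -, h2⟩ | ⟨h1, -, h2⟩ <;> simp [h1, h2, h.ci]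
  · rw [e1]
    exact hc _ le_rfl
  · have := h.ve
    rw [hvx]; omega
  · have := h.vf
    rw [hvx, e1, hv _ le_rfl]; omega

theorem stepB_s15 {x m D R A0 A1 A2 i o e f : ℕ} (h : Inv_s15 x m D R A0 A1 A2 i o e f) (hVx : V x)
    (hk : runo o R 1 ≤ 3) (ho : o ≤ 3) (f' : ℕ) (hf : f' + cnt R 1 = f) :
    Inv_s15 (x + 1) m D (R >>> 1) (A1 >>> 1) (A2 >>> 1) 0 (i + 1) (runo o R 1) e f' := by
  have hno : ∀ w, x ≤ w → ¬ Q x w := by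
    intro w hw hq
    obtain ⟨u, hu, hqu⟩ := hVx
    have := Q_col hq (Q_symm hqu)
    obtain rfl : x = w := by omega
    have := Q_diag (d := 0) Q00 hq
    have := h.hx
    omega
  have := step h 0 0 e f' (i + 1) 1 (by simpa using fun j => hno _ (by omega))
    (by intro z r; simpa using Kn_succ' hno) (by omega)
    (by intro k hk'; simp only [Nat.or_zero]
        rcases k with _ | _ | k
        · exact ho
        · exact hk
        · omega) (Or.inl ⟨hVx, rfl, rfl⟩) (by omega) (by simp only [Nat.or_zero, zero_add]; omega)
  simpa using this

theorem findA {x m D R A0 A1 A2 i o e f : ℕ} (h : Inv_s15 x m D R A0 A1 A2 i o e f) (hVx : ¬ V x)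
    (y : ℕ) (hy : (D ||| R ||| A0).testBit y = false)
    (hyl : ∀ j < y, (D ||| R ||| A0).testBit j = true) : Q x (x + m + y) := by
  have h1 := h.hx
  have h2 := h.hm
  simp only [Nat.testBit_or, Bool.or_eq_false_iff, Bool.or_eq_true] at hy hyl
  obtain ⟨⟨hyD, hyR⟩, hyA⟩ := hy
  have nD : ¬ ∃ u < x, Q u (u + (m + y)) := by rw [← h.dD]; simp [hyD]
  have nR : ¬ ∃ u < x, Q u (x + m + y) := by rw [← h.dR]; simp [hyR]
  have nA : ¬ Kn x x (x + m + y) := by rw [← h.k0]; simp [hyA]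
  apply Q_of
  intro u w hmv hq
  rcases hmv with ⟨k, hk, h1, h2⟩ | ⟨k, hk, h1, h2⟩ | ⟨k, hk, h1, h2⟩ | ⟨h1, h2⟩ | ⟨h1, h2⟩ <;>
    simp only at h1 h2
  · subst h2
    exact nR ⟨u, by omega, hq⟩
  · subst h1
    by_cases hw : w < u
    · exact hVx ⟨w, by omega, Q_symm hq⟩
    · by_cases hwm : w < u + m
      · obtain ⟨u', hu', hq'⟩ := h.dlow (w - u) (by omega)
        have hq2 : Q u (u + (w - u)) := by rwa [show u + (w - u) = w by omega]
        have h9 := Q_diag hq' hq2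
        omega
      · have hw' : w = u + m + (w - (u + m)) := by omega
        rw [hw'] at hq
        rcases hyl (w - (u + m)) (by omega) with (hh | hh) | hh
        · obtain ⟨u', hu', hq'⟩ := (h.dD _).1 hh
          rw [add_assoc] at hq
          have := Q_diag hq' hq
          omega
        · obtain ⟨u', hu', hq'⟩ := (h.dR _).1 hh
          have := Q_row hq' hq
          omega
        · obtain ⟨a, b, ha, hab, hqa, hh⟩ := (h.k0 _).1 hh
          refine Q_not hq ?_ hqa
          unfold Mah23Move
          simp only
          omega
  · refine nD ⟨u, by omega, ?_⟩
    rwa [show u + (m + y) = w by omega]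
  · exact nA ⟨u, w, by omega, by omega, hq, by omega⟩
  · exact nA ⟨u, w, by omega, by omega, hq, by omega⟩

theorem stepA_s15 {x m D R A0 A1 A2 i o e f : ℕ} (h : Inv_s15 x m D R A0 A1 A2 i o e f) (hVx : ¬ V x)
    (y m' : ℕ) (hy : (D ||| R ||| A0).testBit y = false)
    (hyl : ∀ j < y, (D ||| R ||| A0).testBit j = true)
    (hm' : ∀ j < m', (D ||| 2 ^ y).testBit j = true)
    (hk : ∀ k ≤ m' + 1, runo o (R ||| 2 ^ y) k ≤ 3)
    (e' f' : ℕ)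
    (he : e' + m' = e + 1) (hf : f' + cnt (R ||| 2 ^ y) (m' + 1) = f + 1) :
    Inv_s15 (x + 1) (m + m') ((D ||| 2 ^ y) >>> m') ((R ||| 2 ^ y) >>> (m' + 1)) (A1 >>> (m' + 1))
      ((A2 ||| ((2 ^ y) <<< 3)) >>> (m' + 1)) (((2 ^ y) <<< 2) >>> (m' + 1)) 0
      (runo o (R ||| 2 ^ y) (m' + 1)) e' f' := by
  have hq := findA h hVx y hy hyl
  refine step h (2 ^ y) m' e' f' 0 0 ?_ ?_ hm' hk (Or.inr ⟨hVx, rfl, rfl⟩) (by omega) (by omega)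
  · intro j
    rw [Nat.testBit_two_pow]
    simp only [decide_eq_true_eq]
    constructor
    · rintro rfl; exact hq
    · intro hq'
      have := Q_col hq hq'
      omega
  · intro z r
    rw [Kn_succ (by omega) hq]
    simp [Nat.testBit_two_pow]

def tones : ℕ → ℕ → ℕ
  | 0, _ => 0
  | n + 1, M => if M.testBit 0 then tones n (M >>> 1) + 1 else 0

abbrev St := ℕ × ℕ × ℕ × ℕ × ℕ × ℕ × ℕ × ℕ × ℕ

def table : List St := [
  (0,0,0,0,0,0,0,0,0), (0,0,0,0,0,1,0,0,0), (0,0,0,0,0,2,0,0,0), (0,0,0,0,0,3,0,0,0),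
  (0,0,0,1,0,0,0,0,0), (0,0,0,2,1,0,0,0,0), (0,0,0,2,1,1,0,0,0), (0,0,1,0,0,0,0,0,0),
  (0,0,1,0,0,1,0,0,0), (0,0,1,0,0,2,0,0,0), (2,0,0,0,0,0,0,1,0), (2,0,0,0,0,1,0,1,0),
  (2,0,0,0,0,2,0,1,0), (2,0,0,0,0,3,0,1,0), (2,0,1,0,0,0,0,1,0), (2,0,1,0,0,1,0,1,0),
  (2,0,1,0,0,2,0,1,0), (2,0,4,2,0,0,1,1,0), (2,0,4,2,0,1,1,1,0), (2,1,0,8,4,0,0,1,1),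
  (6,0,0,0,0,3,0,2,0), (6,0,2,0,0,2,1,2,0), (6,1,8,4,0,1,0,2,1), (6,1,9,4,0,1,0,2,1),
  (6,2,0,16,8,0,0,2,1), (6,2,4,18,8,0,1,2,1), (22,1,0,0,0,3,0,3,1), (22,2,8,0,0,2,0,3,1),
  (22,4,32,16,0,1,0,3,1), (22,8,2,64,32,0,1,3,1), (30,0,0,0,0,3,1,4,0), (30,1,4,0,0,2,0,4,1),
  (30,2,16,8,0,1,0,4,1), (30,4,0,32,16,0,1,4,1), (62,2,0,0,0,3,0,5,1), (62,4,16,0,0,2,0,5,1),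
  (62,8,64,32,0,1,0,5,1), (62,16,0,128,64,0,1,5,1)]

def yof (s : St) : ℕ :=
  match s with
  | (D, R, A0, _, _, _, _, _, _) => tones 10 (D ||| R ||| A0)

def mof (s : St) : ℕ :=
  match s with
  | (D, _, _, _, _, _, _, _, _) => tones 10 (D ||| 2 ^ yof s)

def chkA (s : St) : Prop :=
  match s with
  | (D, R, A0, A1, A2, _, o, e, f) =>
    (D ||| R ||| A0).testBit (yof s) = false ∧
    (∀ j < yof s, (D ||| R ||| A0).testBit j = true) ∧
    (∀ j < mof s, (D ||| 2 ^ yof s).testBit j = true) ∧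
    (∀ k < mof s + 2, runo o (R ||| 2 ^ yof s) k ≤ 3) ∧
    mof s ≤ e + 1 ∧ cnt (R ||| 2 ^ yof s) (mof s + 1) ≤ f + 1 ∧
    ((D ||| 2 ^ yof s) >>> mof s, (R ||| 2 ^ yof s) >>> (mof s + 1), A1 >>> (mof s + 1),
      (A2 ||| ((2 ^ yof s) <<< 3)) >>> (mof s + 1), ((2 ^ yof s) <<< 2) >>> (mof s + 1), 0,
      runo o (R ||| 2 ^ yof s) (mof s + 1), e + 1 - mof s,
      f + 1 - cnt (R ||| 2 ^ yof s) (mof s + 1)) ∈ table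

def chkB (s : St) : Prop :=
  match s with
  | (D, R, _, A1, A2, i, o, e, f) =>
    i < 3 → runo o R 1 ≤ 3 ∧ o ≤ 3 ∧ cnt R 1 ≤ f ∧
    (D, R >>> 1, A1 >>> 1, A2 >>> 1, 0, i + 1, runo o R 1, e, f - cnt R 1) ∈ table

def chkC (s : St) : Prop :=
  match s with
  | (_, _, _, _, _, _, _, e, f) => e ≤ 5 ∧ f ≤ 1 ∧ yof s ≤ 5

instance (s : St) : Decidable (chkA s) := by unfold chkA; infer_instance
instance (s : St) : Decidable (chkB s) := by unfold chkB; infer_instance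
instance (s : St) : Decidable (chkC s) := by unfold chkC; infer_instance

theorem chk : ∀ s ∈ table, chkA s ∧ chkB s ∧ chkC s := by decide +kernel

def InvS (x m : ℕ) (s : St) : Prop :=
  match s with
  | (D, R, A0, A1, A2, i, o, e, f) => Inv_s15 x m D R A0 A1 A2 i o e f

theorem Q0 {y : ℕ} (h : Q 0 y) : y = 0 := Q_col h Q00

theorem V0 : V 0 := ⟨0, le_rfl, Q00⟩

theorem V1 : ¬ V 1 := by
  rintro ⟨u, hu, hq⟩
  obtain rfl | rfl : u = 0 ∨ u = 1 := by omega
  · have := Q0 hq; omega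
  · have := Q_diag (d := 0) Q00 hq; omega

theorem base : Inv_s15 1 1 0 0 0 2 1 1 0 0 0 := by
  have hc1 : c 1 = 1 := by simp [c, V0]
  have hc2 : c 2 = 0 := by simp [c, V1]
  have hv1 : v 1 = 1 := by simp [v, V0]
  have hv2 : v 2 = 1 := by simp [v, V0, V1]
  have hK : ∀ z r, Kn 1 z r ↔ (z = 2 ∧ r = 3) ∨ (z = 3 ∧ r = 2) := by
    intro z r
    constructor
    · rintro ⟨u, w, hu, huw, hq, hh⟩
      obtain rfl : u = 0 := by omega
      have := Q0 hq
      omega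
    · intro h
      exact ⟨0, 0, by omega, by omega, Q00, by omega⟩
  have hQ : ∀ y, 0 < y → ¬ ∃ u < 1, Q u y := by
    rintro y hy ⟨u, hu, hq⟩
    obtain rfl : u = 0 := by omega
    have := Q0 hq
    omega
  refine ⟨le_rfl, le_rfl, ?_, ?_, ?_, ?_, ?_, ?_, ?_, hc1, hc2, by omega, by
    rw [show 1 + 1 = 2 from rfl]; omega⟩
  · intro d hd
    obtain rfl : d = 0 := by omega
    exact ⟨0, by omega, Q00⟩
  · intro j
    simp only [Nat.zero_testBit, Bool.false_eq_true, false_iff]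
    rintro ⟨u, hu, hq⟩
    obtain rfl : u = 0 := by omega
    have := Q0 hq
    omega
  · intro j
    simp only [Nat.zero_testBit, Bool.false_eq_true, false_iff]
    exact hQ _ (by omega)
  · intro j
    simp only [Nat.zero_testBit, Bool.false_eq_true, false_iff, hK]
    omega
  · intro j
    rw [hK, show (2 : ℕ) = 2 ^ 1 by rfl, Nat.testBit_two_pow, decide_eq_true_eq]
    omega
  · intro j
    rw [hK, show (Nat.testBit 1 j) = (Nat.testBit (2 ^ 0) j) by rfl, Nat.testBit_two_pow,
      decide_eq_true_eq]
    omega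
  · intro r hr
    obtain rfl | rfl | rfl : r = 0 ∨ r = 1 ∨ r = 2 := by omega
    · simp [c]
    · omega
    · omega

theorem main_inv (x : ℕ) (hx : 1 ≤ x) : ∃ m, ∃ s ∈ table, InvS x m s := by
  induction x, hx using Nat.le_induction with
  | base => exact ⟨1, (0, 0, 0, 2, 1, 1, 0, 0, 0), by decide, base⟩
  | succ x hx ih =>
    obtain ⟨m, s, hs, hI⟩ := ih
    obtain ⟨hA, hB, -⟩ := chk s hs
    obtain ⟨D, R, A0, A1, A2, i, o, e, f⟩ := s
    have hI' : Inv_s15 x m D R A0 A1 A2 i o e f := hI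
    by_cases hV : V x
    · have hi : i < 3 := by
        have h1 := hI'.c3 (x + 1) (by have := hI'.hm; omega)
        rw [c, if_pos hV, hI'.ci] at h1
        omega
      obtain ⟨h1, h2, h3, h4⟩ := hB hi
      exact ⟨m, _, h4, stepB_s15 hI' hV h1 h2 _ (by omega)⟩
    · obtain ⟨h1, h2, h3, h4, h5, h6, h7⟩ := hA
      exact ⟨_, _, h7, stepA_s15 hI' hV _ _ h1 h2 h3 (fun k hk => h4 k (by omega)) _ _
        (by omega) (by omega)⟩

theorem summary (x : ℕ) (hx : 1 ≤ x) : ∃ m e f, e ≤ 5 ∧ f ≤ 1 ∧ x + 1 = v x + m + e ∧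
    x + 1 = v x + v (x + m) + f ∧ (¬ V x → ∃ y ≤ 5, Q x (x + m + y)) := by
  obtain ⟨m, s, hs, hI⟩ := main_inv x hx
  obtain ⟨hA, -, hC⟩ := chk s hs
  obtain ⟨D, R, A0, A1, A2, i, o, e, f⟩ := s
  have hI' : Inv_s15 x m D R A0 A1 A2 i o e f := hI
  obtain ⟨c1, c2, c3⟩ := hC
  exact ⟨m, e, f, c1, c2, hI'.ve, hI'.vf, fun hV => ⟨_, c3, findA hI' hV _ hA.1 hA.2.1⟩⟩

theorem v_succ (x : ℕ) : v (x + 1) = v x ∨ v (x + 1) = v x + 1 := by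
  rw [v]; split_ifs <;> simp

theorem v_lip (x k : ℕ) : v x ≤ v (x + k) ∧ v (x + k) ≤ v x + k := by
  induction k with
  | zero => simp
  | succ k ih =>
    have := v_succ (x + k)
    rw [← add_assoc]
    omega

theorem v_le (x : ℕ) : v x ≤ x := by
  have := v_lip 0 x
  simp [v] at this
  exact this

theorem cover (z : ℕ) (hz : 2 ≤ z) : ∃ x, 1 ≤ x ∧ 2 * x + 1 ≤ z + v x ∧ z + v x ≤ 2 * x + 2 := by
  induction z, hz using Nat.le_induction with
  | base => exact ⟨1, le_rfl, by simp [v, V0]⟩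
  | succ z hz ih =>
    obtain ⟨x, h1, h2, h3⟩ := ih
    have := v_succ x
    by_cases h : z + 1 + v x ≤ 2 * x + 2
    · exact ⟨x, h1, by omega, h⟩
    · exact ⟨x + 1, by omega, by omega, by omega⟩

theorem E_bound (t : ℝ) (ht : t ^ 2 - 3 * t + 1 = 0) (h1 : 0.38 ≤ t) (h2 : t ≤ 0.39) (z : ℕ) :
    |(v z : ℝ) - t * z| ≤ 30 := by
  induction z using Nat.strong_induction_on with
  | _ z ih =>
    by_cases hz : z < 2
    · have hv := v_le z
      have h3 : (v z : ℝ) ≤ 2 := by exact_mod_cast (by omega : v z ≤ 2)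
      have h4 : (z : ℝ) ≤ 2 := by exact_mod_cast (by omega : z ≤ 2)
      have h5 : (0 : ℝ) ≤ v z := Nat.cast_nonneg _
      have h6 : (0 : ℝ) ≤ z := Nat.cast_nonneg _
      rw [abs_le]
      constructor <;> nlinarith
    · obtain ⟨x, hx, hz1, hz2⟩ := cover z (by omega)
      obtain ⟨m, e, f, he, hf, hve, hvf, -⟩ := summary x hx
      have hvx := v_le x
      have hE := ih x (by omega)
      have hl := v_lip (x + m) (z - (x + m))
      rw [show x + m + (z - (x + m)) = z by omega] at hl
      have a1 : v z + v x ≤ x + 8 := by omega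
      have a2 : x ≤ v z + v x := by omega
      have b1 : (v z : ℝ) + v x ≤ x + 8 := by exact_mod_cast a1
      have b2 : (x : ℝ) ≤ v z + v x := by exact_mod_cast a2
      have b3 : 2 * (x : ℝ) + 1 ≤ z + v x := by exact_mod_cast hz1
      have b4 : (z : ℝ) + v x ≤ 2 * x + 2 := by exact_mod_cast hz2
      rw [abs_le] at hE ⊢
      obtain ⟨E1, E2⟩ := hE
      have key : (v z : ℝ) - t * z = -(1 - t) * (v x - t * x) + (v z + v x - x)
          - t * (z + v x - 2 * x) := by
        linear_combination (x : ℝ) * ht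
      rw [key]
      constructor <;> nlinarith

end Mah

theorem maharaja23_P_positions_near_golden_line :
    ∃ C : ℝ, 0 < C ∧ ∀ x y : ℕ, Mah23P (x, y) → x ≤ y → |(y : ℝ) - phi * x| ≤ C := by
  refine ⟨50, by norm_num, ?_⟩
  intro x y hq hxy
  have h5 : Real.sqrt 5 ^ 2 = 5 := Real.sq_sqrt (by norm_num)
  have h50 : 0 ≤ Real.sqrt 5 := Real.sqrt_nonneg 5
  have l1 : Real.sqrt 5 ≤ 2.24 := by nlinarith
  have l2 : 2.22 ≤ Real.sqrt 5 := by nlinarith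
  by_cases hx : x = 0
  · subst hx
    have := Mah.Q0 hq
    subst this
    simp
  · obtain ⟨m, e, f, he, hf, hve, hvf, hy⟩ := Mah.summary x (by omega)
    have hV : ¬ Mah.V x := by
      rintro ⟨u, hu, hqu⟩
      have := Mah.Q_col hq (Mah.Q_symm hqu)
      obtain rfl : x = y := by omega
      have := Mah.Q_diag (d := 0) Mah.Q00 hq
      omega
    obtain ⟨k, hk, hq'⟩ := hy hV
    have hyk := Mah.Q_col hq hq'
    have hE := Mah.E_bound ((3 - Real.sqrt 5) / 2) (by nlinarith) (by linarith) (by linarith) x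
    have a1 : y + Mah.v x ≤ 2 * x + 6 := by omega
    have a2 : 2 * x ≤ y + Mah.v x + 5 := by omega
    have b1 : (y : ℝ) + Mah.v x ≤ 2 * x + 6 := by exact_mod_cast a1
    have b2 : 2 * (x : ℝ) ≤ y + Mah.v x + 5 := by exact_mod_cast a2
    unfold phi
    rw [abs_le] at hE ⊢
    constructor <;> linarith [hE.1, hE.2]
end

section
/- In (2,3)-Maharaja Nim, for every k ∈ ℕ there is exactly one y ∈ ℕ such that (k, y) is a P-position, and exactly one x ∈ ℕ such that (x, k) is a P-position. -/
theorem mah_unique {x y z : ℕ} (h1 : Mah23P (x, y)) (h2 : Mah23P (x, z)) : y = z := by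
  by_contra hne
  rcases Nat.lt_or_gt_of_ne hne with h | h
  · rw [Mah23P] at h2
    exact h2 (x, y) (Or.inr (Or.inl ⟨z - y, by omega, rfl, by simp only; omega⟩)) h1
  · rw [Mah23P] at h1
    exact h1 (x, z) (Or.inr (Or.inl ⟨y - z, by omega, rfl, by simp only; omega⟩)) h2

theorem mah_bound (k : ℕ) : ∃ B, ∀ c, c < k → ∀ y, Mah23P (c, y) → y ≤ B := by
  induction k with
  | zero => exact ⟨0, fun c hc => by omega⟩
  | succ k ih =>
    obtain ⟨B, hB⟩ := ih
    by_cases h : ∃ z, Mah23P (k, z)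
    · obtain ⟨z, hz⟩ := h
      refine ⟨B + z, fun c hc y hy => ?_⟩
      rcases Nat.lt_succ_iff_lt_or_eq.mp hc with h | rfl
      · have := hB c h y hy
        omega
      · have := mah_unique hy hz
        omega
    · refine ⟨B, fun c hc y hy => ?_⟩
      rcases Nat.lt_succ_iff_lt_or_eq.mp hc with h' | rfl
      · exact hB c h' y hy
      · exact absurd ⟨y, hy⟩ h

theorem mah_exists (k : ℕ) : ∃ y, Mah23P (k, y) := by
  by_contra hno
  obtain ⟨B, hB⟩ := mah_bound k
  apply hno
  refine ⟨B + k + 4, ?_⟩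
  rw [Mah23P]
  rintro ⟨a, b⟩ hm hP
  have hb := hB a
  rcases hm with ⟨j, hj, h1, h2⟩ | ⟨j, hj, h1, h2⟩ | ⟨j, hj, h1, h2⟩ | ⟨h1, h2⟩ | ⟨h1, h2⟩ <;>
    simp only at h1 h2
  · have := hb (by omega) b hP
    omega
  · subst h1
    exact hno ⟨b, hP⟩
  all_goals
    have := hb (by omega) b hP
    omega

theorem mah_move_swap {p q : ℕ × ℕ} (h : Mah23Move p q) : Mah23Move p.swap q.swap := by
  rcases h with ⟨j, hj, h1, h2⟩ | ⟨j, hj, h1, h2⟩ | ⟨j, hj, h1, h2⟩ | ⟨h1, h2⟩ | ⟨h1, h2⟩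
  · exact Or.inr (Or.inl ⟨j, hj, h2, h1⟩)
  · exact Or.inl ⟨j, hj, h2, h1⟩
  · exact Or.inr (Or.inr (Or.inl ⟨j, hj, h2, h1⟩))
  · exact Or.inr (Or.inr (Or.inr (Or.inr ⟨h2, h1⟩)))
  · exact Or.inr (Or.inr (Or.inr (Or.inl ⟨h2, h1⟩)))

theorem mah_swap (n : ℕ) : ∀ p : ℕ × ℕ, p.1 + p.2 = n → Mah23P p → Mah23P p.swap := by
  induction n using Nat.strong_induction_on with
  | _ n ih =>
    intro p hp h
    rw [Mah23P] at h ⊢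
    intro q hm hq
    have hm' := mah_move_swap hm
    rw [Prod.swap_swap] at hm'
    have hl := hm.lt
    simp only [Prod.fst_swap, Prod.snd_swap] at hl
    exact h q.swap hm' (ih (q.1 + q.2) (by omega) q rfl hq)

theorem maharaja23_row_column_unique (k : ℕ) :
    (∃! y : ℕ, Mah23P (k, y)) ∧ (∃! x : ℕ, Mah23P (x, k)) := by
  obtain ⟨y, hy⟩ := mah_exists k
  exact ⟨⟨y, hy, fun z hz => mah_unique hz hy⟩,
    ⟨y, mah_swap _ (k, y) rfl hy, fun z hz => mah_unique (mah_swap _ (z, k) rfl hz) hy⟩⟩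
end
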